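/- For any choice of the data (any l ≥ 2, μ > 0, integers N_j ≥ 0 and points p_{j,k}), a planar vortex solution (v_1,…,v_l) exists. -/

import Mathlib

open MeasureTheory Real Set Filter

noncomputable section

/-- The plane `ℝ²` with the Euclidean norm. -/
abbrev E2 := EuclideanSpace ℝ (Fin 2)

/-- The Laplacian of a function `f : ℝ² → ℝ`, as the sum of its second partial
derivatives in the coordinate directions. -/
noncomputable def lap (f : E2 → ℝ) (x : E2) : ℝ :=
  ∑ i : Fin 2,
    fderiv ℝ (fun y => fderiv ℝ f y (EuclideanSpace.single i 1)) x (EuclideanSpace.single i 1)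

/-- Vortex data for the planar problem: a parameter `μ > 0` and, for each `j = 1, …, l`,
`N j` points `p j k` in the plane (repetitions allowed). -/
structure PlanarVortexData (l : ℕ) where
  μ : ℝ
  μ_pos : 0 < μ
  N : Fin l → ℕ
  p : ∀ j : Fin l, Fin (N j) → E2

namespace PlanarVortexData

variable {l : ℕ} (D : PlanarVortexData l)

/-- `f_j(x) = Π_{k=1}^{N_j} ‖x − p_{j,k}‖²/(μ + ‖x − p_{j,k}‖²)`. -/
def f (j : Fin l) (x : E2) : ℝ :=
  ∏ k, ‖x - D.p j k‖ ^ 2 / (D.μ + ‖x - D.p j k‖ ^ 2)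

/-- `g_j(x) = Σ_{k=1}^{N_j} 4μ/(μ + ‖x − p_{j,k}‖²)²`. -/
def g (j : Fin l) (x : E2) : ℝ :=
  ∑ k, 4 * D.μ / (D.μ + ‖x - D.p j k‖ ^ 2) ^ 2

end PlanarVortexData

/-- `(v_1, …, v_l)` is a planar vortex solution for the data `D`: each `v_j` is `C²`,
solves `Δ v_j = f_j e^{v_j} + Σ_i f_i e^{v_i} − (l+1) + g_j` on `ℝ²`, and
`v_j(x) → 0` as `‖x‖ → ∞`. -/
def IsPlanarVortexSolution {l : ℕ} (D : PlanarVortexData l) (v : Fin l → E2 → ℝ) : Prop :=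
  ∀ j : Fin l,
    ContDiff ℝ 2 (v j) ∧
    (∀ x : E2, lap (v j) x =
      D.f j x * Real.exp (v j x) + ∑ i, D.f i x * Real.exp (v i x) - (l + 1) + D.g j x) ∧
    Tendsto (v j) (cocompact E2) (nhds 0)

open MeasureTheory Real Set Filter

noncomputable section

/-! ### Elementary facts on the Laplacian -/

theorem differentiable_partial {u : E2 → ℝ} (hu : ContDiff ℝ 2 u) (e : E2) :
    Differentiable ℝ (fun y => fderiv ℝ u y e) := by
  have h : ContDiff ℝ 1 (fderiv ℝ u) := hu.fderiv_right (by norm_num)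
  have h2 := (h.differentiable (by norm_num))
  fun_prop

theorem lap_add {u v : E2 → ℝ} (hu : ContDiff ℝ 2 u) (hv : ContDiff ℝ 2 v) (x : E2) :
    lap (fun y => u y + v y) x = lap u x + lap v x := by
  unfold lap
  rw [← Finset.sum_add_distrib]
  refine Finset.sum_congr rfl fun i _ => ?_
  have h1 : (fun y => fderiv ℝ (fun y => u y + v y) y (EuclideanSpace.single i 1))
      = fun y => fderiv ℝ u y (EuclideanSpace.single i 1)
        + fderiv ℝ v y (EuclideanSpace.single i 1) := by
    funext y
    rw [fderiv_fun_add (hu.differentiable (by norm_num) y) (hv.differentiable (by norm_num) y)]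
    rfl
  rw [h1, fderiv_fun_add (differentiable_partial hu _ x) (differentiable_partial hv _ x)]
  rfl

theorem lap_const_mul {u : E2 → ℝ} (hu : ContDiff ℝ 2 u) (c : ℝ) (x : E2) :
    lap (fun y => c * u y) x = c * lap u x := by
  unfold lap
  rw [Finset.mul_sum]
  refine Finset.sum_congr rfl fun i _ => ?_
  have h1 : (fun y => fderiv ℝ (fun y => c * u y) y (EuclideanSpace.single i 1))
      = fun y => c * fderiv ℝ u y (EuclideanSpace.single i 1) := by
    funext y
    rw [fderiv_const_mul (hu.differentiable (by norm_num) y)]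
    rfl
  rw [h1, fderiv_const_mul (differentiable_partial hu _ x)]
  rfl

theorem lap_sub {u v : E2 → ℝ} (hu : ContDiff ℝ 2 u) (hv : ContDiff ℝ 2 v) (x : E2) :
    lap (fun y => u y - v y) x = lap u x - lap v x := by
  have h := lap_add hu (v := fun y => (-1) * v y) (contDiff_const.mul hv) x
  rw [lap_const_mul hv] at h
  have h2 : (fun y => u y - v y) = fun y => u y + (-1) * v y := by funext y; ring
  rw [h2, h]; ring

theorem lap_zero (x : E2) : lap (fun _ => (0 : ℝ)) x = 0 := by
  unfold lap; simp

theorem lap_sum {α : Type*} (s : Finset α) {u : α → E2 → ℝ} (hu : ∀ a, ContDiff ℝ 2 (u a))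
    (x : E2) : lap (fun y => ∑ a ∈ s, u a y) x = ∑ a ∈ s, lap (u a) x := by
  classical
  induction s using Finset.induction_on with
  | empty => simp [lap_zero]
  | insert a s ha ih =>
    simp only [Finset.sum_insert ha]
    rw [lap_add (hu a) (ContDiff.sum fun a _ => hu a), ih]

theorem norm_sq_E2 (x : E2) : ‖x‖ ^ 2 = x 0 ^ 2 + x 1 ^ 2 := by
  rw [EuclideanSpace.real_norm_sq_eq]; simp

theorem fderiv_norm_sub_sq (p y : E2) :
    HasFDerivAt (fun y : E2 => ‖y - p‖ ^ 2) (2 • (innerSL ℝ (y - p))) y := by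
  have h := ((hasFDerivAt_id y).sub_const p).norm_sq
  rw [ContinuousLinearMap.comp_id] at h
  exact h

theorem inner_single (p : E2) (i : Fin 2) : innerSL ℝ p (EuclideanSpace.single i 1) = p i := by
  simp [innerSL_apply_apply, EuclideanSpace.inner_single_right]

theorem lap_norm_sub_sq (p x : E2) : lap (fun y => ‖y - p‖ ^ 2) x = 4 := by
  unfold lap
  have h : ∀ i : Fin 2, (fun y => fderiv ℝ (fun y : E2 => ‖y - p‖ ^ 2) y
      (EuclideanSpace.single i 1)) = fun y => 2 * (y i - p i) := by
    intro i
    funext y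
    rw [(fderiv_norm_sub_sq p y).fderiv]
    have := inner_single (y - p) i
    simp only [smul_apply, this]
    simp
  have h2 : ∀ i : Fin 2, HasFDerivAt (fun y : E2 => 2 * (y i - p i))
      ((2 : ℝ) • (EuclideanSpace.proj i : E2 →L[ℝ] ℝ)) x := by
    intro i
    have := (((EuclideanSpace.proj i : E2 →L[ℝ] ℝ).hasFDerivAt (x := x)).sub_const (p i)).const_mul 2
    simpa using this
  simp only [h]
  have h3 : ∀ i : Fin 2, fderiv ℝ (fun y : E2 => 2 * (y i - p i)) x
      (EuclideanSpace.single i 1) = 2 := by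
    intro i
    rw [(h2 i).fderiv]
    simp
  simp only [h3]
  simp
  norm_num

theorem contDiff_log_add {η : ℝ} (hη : 0 < η) (p : E2) :
    ContDiff ℝ 2 (fun y : E2 => Real.log (η + ‖y - p‖ ^ 2)) := by
  refine ContDiff.log ?_ ?_
  · exact contDiff_const.add ((contDiff_id.sub contDiff_const).norm_sq ℝ)
  · intro x; positivity

theorem lap_log_add {η : ℝ} (hη : 0 < η) (p x : E2) :
    lap (fun y => Real.log (η + ‖y - p‖ ^ 2)) x = 4 * η / (η + ‖x - p‖ ^ 2) ^ 2 := by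
  unfold lap
  have h : ∀ i : Fin 2, (fun y => fderiv ℝ (fun y : E2 => Real.log (η + ‖y - p‖ ^ 2)) y
      (EuclideanSpace.single i 1)) = fun y => 2 * (y i - p i) / (η + ‖y - p‖ ^ 2) := by
    intro i
    funext y
    have hp : η + ‖y - p‖ ^ 2 ≠ 0 := by positivity
    rw [(((fderiv_norm_sub_sq p y).const_add η).log hp).fderiv]
    have := inner_single (y - p) i
    simp only [smul_apply, this]
    simp
    ring
  have h2 : ∀ i : Fin 2, fderiv ℝ (fun y : E2 => 2 * (y i - p i) / (η + ‖y - p‖ ^ 2)) x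
      (EuclideanSpace.single i 1) = 2 / (η + ‖x - p‖ ^ 2)
        - 4 * (x i - p i) ^ 2 / (η + ‖x - p‖ ^ 2) ^ 2 := by
    intro i
    have hp : η + ‖x - p‖ ^ 2 ≠ 0 := by positivity
    have h3 := (((EuclideanSpace.proj i : E2 →L[ℝ] ℝ).hasFDerivAt (x := x)).sub_const
      (p i)).const_mul 2
    have h4 := h3.fun_mul ((hasDerivAt_inv hp).comp_hasFDerivAt x
      ((fderiv_norm_sub_sq p x).const_add η))
    have h5 : (fun y : E2 => 2 * (y i - p i) / (η + ‖y - p‖ ^ 2)) = fun y : E2 =>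
      2 * ((EuclideanSpace.proj i : E2 →L[ℝ] ℝ) y - p i) * (η + ‖y - p‖ ^ 2)⁻¹ := by
      funext y; simp [div_eq_mul_inv]
    simp only [Function.comp_def] at h4
    rw [h5, h4.fderiv]
    have := inner_single (x - p) i
    simp only [add_apply, smul_apply, this]
    simp
    field_simp
    ring
  simp only [h, h2]
  rw [Fin.sum_univ_two]
  have hp : η + ‖x - p‖ ^ 2 ≠ 0 := by positivity
  have hn := norm_sq_E2 (x - p)
  simp at hn
  have : (η + ‖x - p‖ ^ 2) - ((x 0 - p 0) ^ 2 + (x 1 - p 1) ^ 2) = η := by rw [hn]; ring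
  field_simp
  linarith

/-! ### Maximum principles -/

theorem second_deriv_nonneg {φ : ℝ → ℝ} (hφ : ContDiff ℝ 2 φ) {t : ℝ} (ht : IsLocalMin φ t) :
    0 ≤ deriv (deriv φ) t := by
  by_contra hneg
  push Not at hneg
  have hd : deriv φ t = 0 := ht.deriv_eq_zero
  have hmax := isLocalMax_of_deriv_deriv_neg hneg hd hφ.continuous.continuousAt
  have hc : φ =ᶠ[nhds t] fun _ => φ t := by
    filter_upwards [ht, hmax] with s h1 h2
    exact le_antisymm h2 h1
  have h2 := hc.deriv.deriv_eq
  simp at h2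
  rw [h2] at hneg
  exact lt_irrefl _ hneg

theorem lap_nonneg_of_isLocalMin {u : E2 → ℝ} (hu : ContDiff ℝ 2 u) {x : E2}
    (hx : IsLocalMin u x) : 0 ≤ lap u x := by
  unfold lap
  refine Finset.sum_nonneg fun i _ => ?_
  set e : E2 := EuclideanSpace.single i 1
  have hl : ∀ t : ℝ, HasDerivAt (fun t : ℝ => x + t • e) e t := by
    intro t
    simpa using ((hasDerivAt_id t).smul_const e).const_add x
  have hd : deriv (fun t : ℝ => u (x + t • e)) = fun t => fderiv ℝ u (x + t • e) e := by
    funext t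
    exact ((hu.differentiable (by norm_num) _).hasFDerivAt.comp_hasDerivAt t (hl t)).deriv
  have hd2 : deriv (deriv (fun t : ℝ => u (x + t • e))) 0
      = fderiv ℝ (fun y => fderiv ℝ u y e) x e := by
    rw [hd]
    have h := ((differentiable_partial hu e (x + (0 : ℝ) • e)).hasFDerivAt.comp_hasDerivAt
      (0 : ℝ) (hl 0)).deriv
    simpa [Function.comp_def] using h
  rw [← hd2]
  refine second_deriv_nonneg (hu.comp (by fun_prop)) ?_
  have hcont : ContinuousAt (fun t : ℝ => x + t • e) 0 := by fun_prop
  have hx' : IsLocalMin u (x + (0 : ℝ) • e) := by simpa using hx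
  exact hcont.eventually hx'

/-- Approximate minimum principle on a ball. -/
theorem local_min_principle {u : E2 → ℝ} (hu : ContDiff ℝ 2 u) {x : E2} {R m κ : ℝ}
    (hR : 0 < R) (hm : ∀ y, dist y x ≤ R → m ≤ u y) (hx : u x < m + κ) :
    ∃ y, dist y x ≤ R ∧ u y ≤ u x ∧ -(4 * κ / R ^ 2) ≤ lap u y := by
  set A := κ / R ^ 2 with hA
  have hκ : 0 < κ := by
    have := hm x (by simpa using hR.le)
    linarith
  have hApos : 0 < A := by positivity
  set W : E2 → ℝ := fun y => u y + A * ‖y - x‖ ^ 2 with hW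
  have hq : ContDiff ℝ 2 (fun y : E2 => ‖y - x‖ ^ 2) :=
    (contDiff_id.sub contDiff_const).norm_sq ℝ
  have hWc : ContDiff ℝ 2 W := hu.add (contDiff_const.mul hq)
  obtain ⟨y, hy, hmin⟩ := (isCompact_closedBall x R).exists_isMinOn
    ⟨x, Metric.mem_closedBall_self hR.le⟩ hWc.continuous.continuousOn
  have hyx : W y ≤ W x := hmin (Metric.mem_closedBall_self hR.le)
  have hWx : W x = u x := by simp [hW]
  have hlt : dist y x < R := by
    refine lt_of_le_of_ne hy fun heq => ?_
    have h1 : W y = u y + κ := by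
      simp only [hW, hA]
      rw [← dist_eq_norm, heq]
      field_simp
    have h2 := hm y heq.le
    linarith
  have hloc : IsLocalMin W y :=
    hmin.isLocalMin (Filter.mem_of_superset (Metric.isOpen_ball.mem_nhds hlt)
      Metric.ball_subset_closedBall)
  refine ⟨y, hlt.le, ?_, ?_⟩
  · have : 0 ≤ A * ‖y - x‖ ^ 2 := by positivity
    rw [hWx] at hyx
    simp only [hW] at hyx
    linarith
  · have h := lap_nonneg_of_isLocalMin hWc hloc
    simp only [hW] at h
    rw [lap_add hu (contDiff_const.mul hq), lap_const_mul hq, lap_norm_sub_sq] at h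
    have : 4 * κ / R ^ 2 = A * 4 := by rw [hA]; ring
    linarith

/-- Approximate global minimum principle. -/
theorem global_min_principle {u : E2 → ℝ} (hu : ContDiff ℝ 2 u) {M : ℝ} (hM : ∀ x, M ≤ u x)
    {σ : ℝ} (hσ : 0 < σ) : ∃ y, (∀ x, u y ≤ u x + σ) ∧ -σ ≤ lap u y := by
  have hb : BddBelow (range u) := ⟨M, by rintro _ ⟨x, rfl⟩; exact hM x⟩
  obtain ⟨_, ⟨x, rfl⟩, hx⟩ := Real.lt_sInf_add_pos (range_nonempty u) (show 0 < σ / 4 by linarith)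
  have hinf : ∀ y, sInf (range u) ≤ u y := fun y => csInf_le hb ⟨y, rfl⟩
  obtain ⟨y, -, h1, h2⟩ := local_min_principle hu (x := x) (R := 1) one_pos
    (fun y _ => hinf y) hx
  refine ⟨y, fun z => ?_, ?_⟩
  · have := hinf z
    linarith
  · have : 4 * (σ / 4) / 1 ^ 2 = σ := by ring
    linarith

/-- Approximate global maximum principle. -/
theorem global_max_principle {u : E2 → ℝ} (hu : ContDiff ℝ 2 u) {M : ℝ} (hM : ∀ x, u x ≤ M)
    {σ : ℝ} (hσ : 0 < σ) : ∃ y, (∀ x, u x ≤ u y + σ) ∧ lap u y ≤ σ := by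
  obtain ⟨y, h1, h2⟩ := global_min_principle (u := fun y => (-1) * u y) (contDiff_const.mul hu)
    (M := -M) (fun x => by have := hM x; linarith) hσ
  refine ⟨y, fun x => by have := h1 x; linarith, ?_⟩
  rw [lap_const_mul hu] at h2
  linarith

/-- Minimum principle near infinity. -/
theorem min_principle_infinity {u : E2 → ℝ} (hu : ContDiff ℝ 2 u) {M : ℝ} (hM : ∀ x, |u x| ≤ M)
    {s δ : ℝ} (hδ : 0 < δ)
    (h : ∀ᶠ y in cocompact E2, u y < s → lap u y ≤ -δ) : ∀ᶠ y in cocompact E2, s ≤ u y := by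
  have hM0 : 0 ≤ M := (abs_nonneg _).trans (hM 0)
  rw [← Metric.cobounded_eq_cocompact] at h ⊢
  rw [(Metric.hasBasis_cobounded_compl_closedBall (0 : E2)).eventually_iff] at h
  obtain ⟨R0, -, hR0⟩ := h
  obtain ⟨R, hR1, hR2⟩ : ∃ R : ℝ, 1 ≤ R ∧ 4 * (2 * M + 1) < δ * R := by
    refine ⟨max 1 (4 * (2 * M + 1) / δ + 1), le_max_left _ _, ?_⟩
    have := le_max_right 1 (4 * (2 * M + 1) / δ + 1)
    calc 4 * (2 * M + 1) = δ * (4 * (2 * M + 1) / δ) := by field_simp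
      _ < δ * (4 * (2 * M + 1) / δ + 1) := by nlinarith
      _ ≤ _ := by gcongr
  rw [(Metric.hasBasis_cobounded_compl_closedBall (0 : E2)).eventually_iff]
  refine ⟨R0 + R, trivial, fun x hx => ?_⟩
  by_contra hlt
  push Not at hlt
  obtain ⟨y, hy1, hy2, hy3⟩ := local_min_principle hu (x := x) (R := R) (m := -M)
    (κ := 2 * M + 1) (by linarith) (fun y _ => (abs_le.1 (hM y)).1)
    (by have := (abs_le.1 (hM x)).2; linarith)
  have hy : y ∈ (Metric.closedBall (0 : E2) R0)ᶜ := by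
    simp only [mem_compl_iff, Metric.mem_closedBall, not_le] at hx ⊢
    have := dist_triangle x y 0
    rw [dist_comm x y] at this
    linarith
  have := hR0 hy (by linarith)
  have h4 : 4 * (2 * M + 1) / R ^ 2 < δ := by
    rw [div_lt_iff₀ (by positivity)]
    nlinarith [mul_nonneg hδ.le (mul_nonneg (show (0:ℝ) ≤ R by linarith) (sub_nonneg.2 hR1))]
  linarith

end

open MeasureTheory Real Set Filter

noncomputable section

/-! ### Averaging operators -/

/-- The measure space of the averaging: `(0, ∞) × ℝ²`. -/
def mQ : Measure (ℝ × E2) := (volume.restrict (Ioi (0 : ℝ))).prod volume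

instance : SFinite mQ := by unfold mQ; infer_instance

/-- The weighted average of `h` around `x`. -/
def J {F : Type*} [NormedAddCommGroup F] [NormedSpace ℝ F] (ω : ℝ × E2 → ℝ) (h : E2 → F)
    (x : E2) : F := ∫ q, ω q • h (x + q.1 • q.2) ∂mQ

section J
variable {F : Type*} [NormedAddCommGroup F] [NormedSpace ℝ F] {ω : ℝ × E2 → ℝ} {h : E2 → F}
  {C : ℝ}

theorem J_meas (hω : Integrable ω mQ) (hc : Continuous h) (x : E2) :
    AEStronglyMeasurable (fun q : ℝ × E2 => ω q • h (x + q.1 • q.2)) mQ := by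
  refine hω.aestronglyMeasurable.smul ?_
  have : Continuous (fun q : ℝ × E2 => h (x + q.1 • q.2)) := by fun_prop
  exact this.aestronglyMeasurable

theorem J_integrable (hω : Integrable ω mQ) (hc : Continuous h) (hb : ∀ y, ‖h y‖ ≤ C) (x : E2) :
    Integrable (fun q : ℝ × E2 => ω q • h (x + q.1 • q.2)) mQ := by
  refine (hω.norm.mul_const C).mono' (J_meas hω hc x) (Eventually.of_forall fun q => ?_)
  rw [norm_smul]
  gcongr
  exact hb _

theorem J_bound (hω : Integrable ω mQ) (hb : ∀ y, ‖h y‖ ≤ C) (x : E2) :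
    ‖J ω h x‖ ≤ (∫ q, ‖ω q‖ ∂mQ) * C := by
  unfold J
  rw [← integral_mul_const]
  refine norm_integral_le_of_norm_le (hω.norm.mul_const C) (Eventually.of_forall fun q => ?_)
  rw [norm_smul]
  gcongr
  exact hb _

theorem J_continuous (hω : Integrable ω mQ) (hc : Continuous h) (hb : ∀ y, ‖h y‖ ≤ C) :
    Continuous (J ω h) := by
  unfold J
  refine continuous_of_dominated (fun x => J_meas hω hc x) (bound := fun q => ‖ω q‖ * C)
    (fun x => Eventually.of_forall fun q => ?_) (hω.norm.mul_const C)
    (Eventually.of_forall fun q => by fun_prop)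
  rw [norm_smul]
  gcongr
  exact hb _

theorem J_hasFDerivAt (hω : Integrable ω mQ) (hc : ContDiff ℝ 1 h) (hb : ∀ y, ‖h y‖ ≤ C)
    (hb' : ∀ y, ‖fderiv ℝ h y‖ ≤ C) (x : E2) :
    HasFDerivAt (J ω h) (J ω (fderiv ℝ h) x) x := by
  unfold J
  refine hasFDerivAt_integral_of_dominated_of_fderiv_le (s := univ)
    (F' := fun x q => ω q • fderiv ℝ h (x + q.1 • q.2)) (bound := fun q => ‖ω q‖ * C) univ_mem
    (Eventually.of_forall fun x => J_meas hω hc.continuous x)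
    (J_integrable hω hc.continuous hb x) (J_meas hω (hc.continuous_fderiv (by norm_num)) x)
    (Eventually.of_forall fun q y _ => ?_) (hω.norm.mul_const C)
    (Eventually.of_forall fun q y _ => ?_)
  · rw [norm_smul]
    gcongr
    exact hb' _
  · have h1 := (hc.differentiable (by norm_num) (y + q.1 • q.2)).hasFDerivAt
    have h2 := h1.comp y ((hasFDerivAt_id y).add_const (q.1 • q.2))
    rw [ContinuousLinearMap.comp_id] at h2
    exact h2.const_smul (ω q)

theorem J_contDiff (hω : Integrable ω mQ) (hc : ContDiff ℝ 1 h) (hb : ∀ y, ‖h y‖ ≤ C)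
    (hb' : ∀ y, ‖fderiv ℝ h y‖ ≤ C) : ContDiff ℝ 1 (J ω h) := by
  rw [contDiff_one_iff_fderiv]
  have h1 := J_hasFDerivAt hω hc hb hb'
  refine ⟨fun x => (h1 x).differentiableAt, ?_⟩
  have : fderiv ℝ (J ω h) = J ω (fderiv ℝ h) := by funext x; exact (h1 x).fderiv
  rw [this]
  exact J_continuous hω (hc.continuous_fderiv (by norm_num)) hb'

end J

theorem J_sub {ω : ℝ × E2 → ℝ} (hω : Integrable ω mQ) {h k : E2 → ℝ} {C C' : ℝ}
    (hc : Continuous h) (hb : ∀ y, ‖h y‖ ≤ C) (kc : Continuous k) (kb : ∀ y, ‖k y‖ ≤ C') (x : E2) :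
    J ω (fun y => h y - k y) x = J ω h x - J ω k x := by
  unfold J
  rw [← integral_sub (J_integrable hω hc hb x) (J_integrable hω kc kb x)]
  simp only [smul_sub]

theorem J_apply {ω : ℝ × E2 → ℝ} (hω : Integrable ω mQ) {h : E2 → ℝ} {C : ℝ}
    (hc : ContDiff ℝ 1 h) (hb' : ∀ y, ‖fderiv ℝ h y‖ ≤ C) (x e : E2) :
    J ω (fderiv ℝ h) x e = J ω (fun y => fderiv ℝ h y e) x := by
  unfold J
  rw [ContinuousLinearMap.integral_apply
    (J_integrable hω (hc.continuous_fderiv (by norm_num)) hb' x)]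
  rfl

/-! ### The resolvent of the Laplacian -/

/-- The Gaussian density. -/
def gam (z : E2) : ℝ := Real.exp (-‖z‖ ^ 2) / π

theorem integrable_exp_norm {b : ℝ} (hb : 0 < b) :
    Integrable (fun z : E2 => Real.exp (-b * ‖z‖ ^ 2)) := by
  have h := (GaussianFourier.integrable_cexp_neg_mul_sq_norm_add (V := E2) (b := (b : ℂ))
    (by simpa using hb) 0 0).norm
  refine h.congr (Eventually.of_forall fun z => ?_)
  simp only [Complex.norm_exp]
  congr 1
  simp [← Complex.ofReal_pow, ← Complex.ofReal_mul, ← Complex.ofReal_neg]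

theorem gam_integrable : Integrable gam := by
  have h := (integrable_exp_norm (b := 1) one_pos).div_const π
  simp only [neg_mul, one_mul] at h
  exact h

theorem gam_integral : ∫ z, gam z = 1 := by
  have h := GaussianFourier.integral_rexp_neg_mul_sq_norm (V := E2) (b := 1) one_pos
  simp at h
  unfold gam
  rw [integral_div, h]
  field_simp

theorem gam_nonneg (z : E2) : 0 ≤ gam z := by unfold gam; positivity

theorem coord_le_norm (z : E2) (i : Fin 2) : |z i| ≤ ‖z‖ := by
  simpa using PiLp.norm_apply_le z i

theorem mul_gam_integrable (i : Fin 2) : Integrable (fun z : E2 => z i * gam z) := by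
  have h := ((integrable_exp_norm (b := 1 / 2) (by norm_num)).div_const π)
  refine h.mono' ?_ (Eventually.of_forall fun z => ?_)
  · have : Continuous (fun z : E2 => z i * gam z) := by
      unfold gam
      fun_prop
    exact this.aestronglyMeasurable
  · rw [norm_mul, norm_of_nonneg (gam_nonneg z)]
    unfold gam
    have h1 : ‖z i‖ ≤ Real.exp (1 / 2 * ‖z‖ ^ 2) := by
      refine (coord_le_norm z i).trans ?_
      have := Real.add_one_le_exp (1 / 2 * ‖z‖ ^ 2)
      nlinarith [sq_nonneg (‖z‖ - 1)]
    calc ‖z i‖ * (Real.exp (-‖z‖ ^ 2) / π)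
        ≤ Real.exp (1 / 2 * ‖z‖ ^ 2) * (Real.exp (-‖z‖ ^ 2) / π) := by gcongr
      _ = Real.exp (-(1 / 2) * ‖z‖ ^ 2) / π := by
        rw [mul_div_assoc', ← Real.exp_add]; ring_nf

/-- The weight of the resolvent. -/
def wR (lam : ℝ) (q : ℝ × E2) : ℝ := (q.1 / 2 * Real.exp (-(lam / 4) * q.1 ^ 2)) * gam q.2

/-- The weight of the derivative of the resolvent. -/
def wD (lam : ℝ) (i : Fin 2) (q : ℝ × E2) : ℝ :=
  Real.exp (-(lam / 4) * q.1 ^ 2) * (q.2 i * gam q.2)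

variable {lam : ℝ}

theorem wR_integrable (hl : 0 < lam) : Integrable (wR lam) mQ := by
  have h := ((integrable_mul_exp_neg_mul_sq (b := lam / 4) (by positivity)).div_const 2).restrict
    (s := Ioi (0 : ℝ))
  have h2 := h.mul_prod gam_integrable
  refine h2.congr (Eventually.of_forall fun q => ?_)
  simp only [wR]
  ring

theorem wD_integrable (hl : 0 < lam) (i : Fin 2) : Integrable (wD lam i) mQ := by
  have h := (integrable_exp_neg_mul_sq (b := lam / 4) (by positivity)).restrict
    (s := Ioi (0 : ℝ))
  exact h.mul_prod (mul_gam_integrable i)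

theorem ae_pos : ∀ᵐ q ∂mQ, 0 < q.1 := by
  have h : ∀ᵐ s ∂(volume.restrict (Ioi (0 : ℝ))), 0 < s := ae_restrict_mem measurableSet_Ioi
  exact Measure.quasiMeasurePreserving_fst.ae h

theorem wR_integral (hl : 0 < lam) : ∫ q, ‖wR lam q‖ ∂mQ = 1 / lam := by
  have h1 : ∫ q, ‖wR lam q‖ ∂mQ = ∫ q, wR lam q ∂mQ := by
    refine integral_congr_ae ?_
    filter_upwards [ae_pos] with q hq
    refine norm_of_nonneg ?_
    unfold wR
    have := gam_nonneg q.2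
    positivity
  rw [h1]
  unfold wR mQ
  rw [integral_prod_mul (fun s : ℝ => s / 2 * Real.exp (-(lam / 4) * s ^ 2)) gam, gam_integral]
  have h2 := integral_mul_cexp_neg_mul_sq (b := ((lam / 4 : ℝ) : ℂ)) (by simpa using hl)
  have h3 : ∫ s in Ioi (0 : ℝ), s * Real.exp (-(lam / 4) * s ^ 2) = (2 * (lam / 4))⁻¹ := by
    have h4 : ((∫ s in Ioi (0 : ℝ), s * Real.exp (-(lam / 4) * s ^ 2) : ℝ) : ℂ)
        = (((2 * (lam / 4))⁻¹ : ℝ) : ℂ) := by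
      rw [← integral_complex_ofReal]
      push_cast
      push_cast at h2
      exact h2
    exact_mod_cast h4
  have h5 : ∀ s : ℝ, s / 2 * Real.exp (-(lam / 4) * s ^ 2)
      = (s * Real.exp (-(lam / 4) * s ^ 2)) / 2 := fun s => by ring
  simp only [h5]
  rw [integral_div, h3]
  field_simp
  norm_num

/-- Bounded `C¹` functions with bounded derivative. -/
structure CB1 (h : E2 → ℝ) : Prop where
  contDiff : ContDiff ℝ 1 h
  bdd : ∃ C, (∀ y, ‖h y‖ ≤ C) ∧ ∀ y, ‖fderiv ℝ h y‖ ≤ C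

theorem fderiv_gam (z : E2) (i : Fin 2) :
    fderiv ℝ gam z (EuclideanSpace.single i 1) = -(2 * (z i * gam z)) := by
  have h1 := fderiv_norm_sub_sq 0 z
  simp only [sub_zero] at h1
  have h2 := (h1.fun_neg.exp).mul_const (π⁻¹)
  have h3 : gam = fun z : E2 => Real.exp (-‖z‖ ^ 2) * π⁻¹ := by
    funext z; rw [gam, div_eq_mul_inv]
  rw [h3, h2.fderiv]
  have := inner_single z i
  simp only [smul_apply, neg_apply, this]
  simp
  ring

theorem gam_differentiable : Differentiable ℝ gam := by
  have h3 : gam = fun z : E2 => Real.exp (-‖z‖ ^ 2) * π⁻¹ := by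
    funext z; rw [gam, div_eq_mul_inv]
  rw [h3]
  intro z
  have h1 := fderiv_norm_sub_sq 0 z
  simp only [sub_zero] at h1
  exact ((h1.fun_neg.exp).mul_const (π⁻¹)).differentiableAt

theorem integrable_mul_bdd {ρ : E2 → ℝ} (hρ : Integrable ρ) {k : E2 → ℝ} (hk : Continuous k)
    {C : ℝ} (hC : ∀ y, ‖k y‖ ≤ C) : Integrable (fun z => ρ z * k z) :=
  hρ.mul_bdd hk.aestronglyMeasurable (Eventually.of_forall hC)

/-- Gaussian integration by parts. -/
theorem gam_ibp {h : E2 → ℝ} (hh : CB1 h) (x : E2) (s : ℝ) (i : Fin 2) :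
    ∫ z, gam z * (s * fderiv ℝ h (x + s • z) (EuclideanSpace.single i 1))
      = ∫ z, 2 * (z i * gam z) * h (x + s • z) := by
  obtain ⟨C, hC1, hC2⟩ := hh.bdd
  have hcd := hh.contDiff
  have hfd : Continuous (fderiv ℝ h) := hcd.continuous_fderiv (by norm_num)
  have hd : ∀ z, HasFDerivAt (fun z : E2 => h (x + s • z)) (s • fderiv ℝ h (x + s • z)) z := by
    intro z
    have h2 := ((hcd.differentiable (by norm_num) (x + s • z)).hasFDerivAt).comp z
      (((hasFDerivAt_id z).const_smul s).const_add x)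
    rw [ContinuousLinearMap.comp_smul, ContinuousLinearMap.comp_id] at h2
    exact h2
  have he : ∀ z, fderiv ℝ (fun z : E2 => h (x + s • z)) z (EuclideanSpace.single i 1)
      = s * fderiv ℝ h (x + s • z) (EuclideanSpace.single i 1) := by
    intro z; rw [(hd z).fderiv]; rfl
  have key := integral_mul_fderiv_eq_neg_fderiv_mul_of_integrable (μ := (volume : Measure E2))
    (f := gam) (g := fun z : E2 => h (x + s • z)) (v := EuclideanSpace.single i 1) ?_ ?_ ?_ ?_ ?_
  · simp only [he, fderiv_gam] at key
    rw [key, ← integral_neg]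
    congr 1
    funext z
    ring
  · simp only [fderiv_gam]
    exact integrable_mul_bdd ((mul_gam_integrable i).const_mul 2).neg (hcd.continuous.comp (by fun_prop))
      (fun y => hC1 _)
  · simp only [he]
    refine integrable_mul_bdd gam_integrable (C := |s| * C) ?_ fun y => ?_
    · exact continuous_const.mul ((hfd.comp (by fun_prop)).clm_apply continuous_const)
    · rw [norm_mul]
      refine mul_le_mul le_rfl ?_ (norm_nonneg _) (abs_nonneg _)
      refine (ContinuousLinearMap.le_opNorm _ _).trans ?_
      simpa using hC2 _
  · exact integrable_mul_bdd gam_integrable (hcd.continuous.comp (by fun_prop)) (fun y => hC1 _)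
  · intro z _; exact gam_differentiable z
  · intro z _; exact (hd z).differentiableAt

theorem CB1.partial_bdd {h : E2 → ℝ} (hh : CB1 h) :
    ∃ C, ∀ (i : Fin 2) (y : E2), ‖fderiv ℝ h y (EuclideanSpace.single i 1)‖ ≤ C := by
  obtain ⟨C, hC1, hC2⟩ := hh.bdd
  refine ⟨C, fun i y => (ContinuousLinearMap.le_opNorm _ _).trans ?_⟩
  simpa using hC2 y

theorem CB1.partial_cont {h : E2 → ℝ} (hh : CB1 h) (e : E2) :
    Continuous (fun y => fderiv ℝ h y e) :=
  (hh.contDiff.continuous_fderiv (by norm_num)).clm_apply continuous_const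

theorem J_ibp (hl : 0 < lam) {h : E2 → ℝ} (hh : CB1 h) (x : E2) (i : Fin 2) :
    J (wR lam) (fun y => fderiv ℝ h y (EuclideanSpace.single i 1)) x = J (wD lam i) h x := by
  obtain ⟨C, hC1, hC2⟩ := hh.bdd
  obtain ⟨C', hC'⟩ := hh.partial_bdd
  have i1 := J_integrable (wR_integrable hl) (hh.partial_cont _) (hC' i) x
  have i2 := J_integrable (wD_integrable hl i) hh.contDiff.continuous hC1 x
  unfold J
  unfold mQ at i1 i2 ⊢
  rw [integral_prod _ i1, integral_prod _ i2]
  congr 1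
  funext s
  have key := gam_ibp hh x s i
  have h1 : ∀ z : E2, wR lam (s, z) • fderiv ℝ h (x + s • z) (EuclideanSpace.single i 1)
      = (Real.exp (-(lam / 4) * s ^ 2) / 2) *
        (gam z * (s * fderiv ℝ h (x + s • z) (EuclideanSpace.single i 1))) := by
    intro z; simp only [wR, smul_eq_mul]; ring
  have h2 : ∀ z : E2, wD lam i (s, z) • h (x + s • z)
      = (Real.exp (-(lam / 4) * s ^ 2) / 2) * (2 * (z i * gam z) * h (x + s • z)) := by
    intro z; simp only [wD, smul_eq_mul]; ring
  simp only [h1, h2, integral_const_mul, key]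

/-- The resolvent. -/
def Res (lam : ℝ) (h : E2 → ℝ) : E2 → ℝ := J (wR lam) h

/-- The gradient of the resolvent. -/
def ResD (lam : ℝ) (h : E2 → ℝ) (x : E2) : E2 →L[ℝ] ℝ :=
  ∑ i : Fin 2, J (wD lam i) h x • (EuclideanSpace.proj i : E2 →L[ℝ] ℝ)

theorem clm_ext_E2 {A B : E2 →L[ℝ] ℝ}
    (h : ∀ i, A (EuclideanSpace.single i 1) = B (EuclideanSpace.single i 1)) : A = B := by
  have h1 : (A : E2 →ₗ[ℝ] ℝ) = B :=
    (EuclideanSpace.basisFun (Fin 2) ℝ).toBasis.ext fun i => by simpa using h i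
  exact ContinuousLinearMap.coe_injective h1

theorem ResD_single (h : E2 → ℝ) (x : E2) (i : Fin 2) :
    ResD lam h x (EuclideanSpace.single i 1) = J (wD lam i) h x := by
  unfold ResD
  fin_cases i <;> simp [Fin.sum_univ_two, -PiLp.proj_apply]

theorem Res_hasFDerivAt (hl : 0 < lam) {h : E2 → ℝ} (hh : CB1 h) (x : E2) :
    HasFDerivAt (Res lam h) (ResD lam h x) x := by
  obtain ⟨C, hC1, hC2⟩ := hh.bdd
  have h1 := J_hasFDerivAt (wR_integrable hl) hh.contDiff hC1 hC2 x
  have h2 : ResD lam h x = J (wR lam) (fderiv ℝ h) x := by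
    refine clm_ext_E2 fun i => ?_
    rw [ResD_single, J_apply (wR_integrable hl) hh.contDiff hC2, J_ibp hl hh]
  rw [h2]
  exact h1

theorem Res_contDiff (hl : 0 < lam) {h : E2 → ℝ} (hh : CB1 h) : ContDiff ℝ 2 (Res lam h) := by
  obtain ⟨C, hC1, hC2⟩ := hh.bdd
  have h1 := Res_hasFDerivAt hl hh
  have h2 : fderiv ℝ (Res lam h) = ResD lam h := by funext x; exact (h1 x).fderiv
  have : (2 : WithTop ℕ∞) = 1 + 1 := by norm_num
  rw [this, contDiff_succ_iff_fderiv]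
  refine ⟨fun x => (h1 x).differentiableAt, by simp, ?_⟩
  rw [h2]
  unfold ResD
  exact ContDiff.sum fun i _ =>
    (J_contDiff (wD_integrable hl i) hh.contDiff hC1 hC2).smul contDiff_const

/-- The radial integral. -/
theorem radial_integral (hl : 0 < lam) {h : E2 → ℝ} (hh : CB1 h) (x z : E2) :
    ∫ s in Ioi (0 : ℝ), (Real.exp (-(lam / 4) * s ^ 2) * fderiv ℝ h (x + s • z) z
      - lam / 2 * (s * Real.exp (-(lam / 4) * s ^ 2)) * h (x + s • z)) = - h x := by
  obtain ⟨C, hC1, hC2⟩ := hh.bdd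
  have hcd := hh.contDiff
  have hfd : Continuous (fderiv ℝ h) := hcd.continuous_fderiv (by norm_num)
  have hd : ∀ s : ℝ, HasDerivAt (fun s : ℝ => Real.exp (-(lam / 4) * s ^ 2) * h (x + s • z))
      (Real.exp (-(lam / 4) * s ^ 2) * fderiv ℝ h (x + s • z) z
      - lam / 2 * (s * Real.exp (-(lam / 4) * s ^ 2)) * h (x + s • z)) s := by
    intro s
    have h1 : HasDerivAt (fun s : ℝ => x + s • z) z s := by
      simpa using ((hasDerivAt_id s).smul_const z).const_add x
    have h2 := ((hcd.differentiable (by norm_num) (x + s • z)).hasFDerivAt).comp_hasDerivAt s h1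
    have h3 : HasDerivAt (fun s : ℝ => Real.exp (-(lam / 4) * s ^ 2))
        (Real.exp (-(lam / 4) * s ^ 2) * (-(lam / 4) * (2 * s))) s := by
      have := ((hasDerivAt_pow 2 s).const_mul (-(lam / 4))).exp
      simpa using this
    have h4 := h3.fun_mul h2
    simp only [Function.comp_def] at h4
    refine h4.congr_deriv ?_
    ring
  have hi1 := (integrable_exp_neg_mul_sq (b := lam / 4) (by positivity))
  have hi2 := (integrable_mul_exp_neg_mul_sq (b := lam / 4) (by positivity)).const_mul (lam / 2)
  have key := integral_Ioi_of_hasDerivAt_of_tendsto' (a := 0) (m := 0) (fun s _ => hd s) ?_ ?_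
  · rw [key]; simp
  · refine (Integrable.sub ?_ ?_).integrableOn
    · refine hi1.mul_bdd (c := C * ‖z‖) ?_ (Eventually.of_forall fun s => ?_)
      · exact ((hfd.comp (by fun_prop)).clm_apply continuous_const).aestronglyMeasurable
      · refine (ContinuousLinearMap.le_opNorm _ _).trans ?_
        gcongr
        exact hC2 _
    · refine hi2.mul_bdd (c := C) ?_ (Eventually.of_forall fun s => hC1 _)
      exact (hcd.continuous.comp (by fun_prop)).aestronglyMeasurable
  · have ht : Tendsto (fun s : ℝ => Real.exp (-(lam / 4) * s ^ 2)) atTop (nhds 0) := by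
      refine Real.tendsto_exp_atBot.comp ?_
      exact (tendsto_pow_atTop (by norm_num)).const_mul_atTop_of_neg (by linarith)
    have hb : IsBoundedUnder (· ≤ ·) atTop ((‖·‖) ∘ fun s : ℝ => h (x + s • z)) :=
      isBoundedUnder_of ⟨C, fun s => hC1 _⟩
    exact (ht.zero_mul_isBoundedUnder_le hb)

theorem Res_lap (hl : 0 < lam) {h : E2 → ℝ} (hh : CB1 h) (x : E2) :
    lap (Res lam h) x = lam * Res lam h x - h x := by
  obtain ⟨C, hC1, hC2⟩ := hh.bdd
  obtain ⟨C', hC'⟩ := hh.partial_bdd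
  have h1 : lap (Res lam h) x
      = ∑ i : Fin 2, J (wD lam i) (fun y => fderiv ℝ h y (EuclideanSpace.single i 1)) x := by
    unfold lap
    refine Finset.sum_congr rfl fun i _ => ?_
    have h2 : (fun y => fderiv ℝ (Res lam h) y (EuclideanSpace.single i 1))
        = J (wD lam i) h := by
      funext y
      rw [(Res_hasFDerivAt hl hh y).fderiv, ResD_single]
    rw [h2, (J_hasFDerivAt (wD_integrable hl i) hh.contDiff hC1 hC2 x).fderiv,
      J_apply (wD_integrable hl i) hh.contDiff hC2]
  have iD : ∀ i : Fin 2, Integrable (fun q : ℝ × E2 => wD lam i q •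
      fderiv ℝ h (x + q.1 • q.2) (EuclideanSpace.single i 1)) mQ := fun i =>
    J_integrable (wD_integrable hl i) (hh.partial_cont _) (hC' i) x
  have iR := J_integrable (wR_integrable hl) hh.contDiff.continuous hC1 x
  have h2 : lap (Res lam h) x - lam * Res lam h x = ∫ q, ((∑ i : Fin 2, wD lam i q •
      fderiv ℝ h (x + q.1 • q.2) (EuclideanSpace.single i 1))
      - lam * (wR lam q • h (x + q.1 • q.2))) ∂mQ := by
    rw [h1, integral_sub (integrable_finsetSum _ fun i _ => iD i) (iR.const_mul lam),
      integral_finsetSum _ (fun i _ => iD i), integral_const_mul]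
    rfl
  have h3 : ∀ q : ℝ × E2, (∑ i : Fin 2, wD lam i q •
      fderiv ℝ h (x + q.1 • q.2) (EuclideanSpace.single i 1))
      - lam * (wR lam q • h (x + q.1 • q.2)) = gam q.2 * (Real.exp (-(lam / 4) * q.1 ^ 2)
        * fderiv ℝ h (x + q.1 • q.2) q.2
      - lam / 2 * (q.1 * Real.exp (-(lam / 4) * q.1 ^ 2)) * h (x + q.1 • q.2)) := by
    intro q
    have hz : q.2 = q.2 0 • EuclideanSpace.single (0 : Fin 2) (1 : ℝ)
        + q.2 1 • EuclideanSpace.single (1 : Fin 2) (1 : ℝ) := by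
      ext i; fin_cases i <;> simp
    have h4 : fderiv ℝ h (x + q.1 • q.2) q.2
        = q.2 0 * fderiv ℝ h (x + q.1 • q.2) (EuclideanSpace.single 0 1)
        + q.2 1 * fderiv ℝ h (x + q.1 • q.2) (EuclideanSpace.single 1 1) := by
      generalize fderiv ℝ h (x + q.1 • q.2) = A
      conv_lhs => rw [hz]
      rw [map_add, map_smul, map_smul]
      rfl
    rw [h4, Fin.sum_univ_two]
    simp only [wD, wR, smul_eq_mul]
    ring
  have i3 := (integrable_finsetSum Finset.univ fun i _ => iD i).sub (iR.const_mul lam)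
  have i4 : Integrable (fun q : ℝ × E2 => gam q.2 * (Real.exp (-(lam / 4) * q.1 ^ 2)
        * fderiv ℝ h (x + q.1 • q.2) q.2
      - lam / 2 * (q.1 * Real.exp (-(lam / 4) * q.1 ^ 2)) * h (x + q.1 • q.2))) mQ := by
    refine i3.congr (Eventually.of_forall fun q => ?_)
    exact h3 q
  simp only [h3] at h2
  have h5 : lap (Res lam h) x - lam * Res lam h x = - h x := by
    rw [h2]
    unfold mQ at i4 ⊢
    rw [integral_prod_symm _ i4]
    simp only [integral_const_mul, radial_integral hl hh]
    rw [integral_mul_const, gam_integral, one_mul]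
  linarith

theorem Res_bound (hl : 0 < lam) {h : E2 → ℝ} {C : ℝ} (hb : ∀ y, ‖h y‖ ≤ C) (x : E2) :
    ‖Res lam h x‖ ≤ C / lam := by
  have := J_bound (wR_integrable hl) hb x
  rw [wR_integral hl] at this
  unfold Res
  calc _ ≤ _ := this
    _ = _ := by ring

theorem ResD_bound (lam : ℝ) (hl : 0 < lam) : ∃ K, 0 ≤ K ∧ ∀ (h : E2 → ℝ) (C : ℝ),
    (∀ y, ‖h y‖ ≤ C) → ∀ x, ‖ResD lam h x‖ ≤ K * C := by
  refine ⟨∑ i : Fin 2, (∫ q, ‖wD lam i q‖ ∂mQ) * ‖(EuclideanSpace.proj i : E2 →L[ℝ] ℝ)‖,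
    by positivity, fun h C hb x => ?_⟩
  unfold ResD
  refine (norm_sum_le _ _).trans ?_
  rw [Finset.sum_mul]
  refine Finset.sum_le_sum fun i _ => ?_
  rw [norm_smul]
  have := J_bound (wD_integrable hl i) hb x
  calc _ ≤ ((∫ q, ‖wD lam i q‖ ∂mQ) * C) * ‖(EuclideanSpace.proj i : E2 →L[ℝ] ℝ)‖ := by gcongr
    _ = _ := by ring

end

open MeasureTheory Real Set Filter

noncomputable section

/-! ### The class `CB1` -/

theorem CB1.const (c : ℝ) : CB1 (fun _ => c) :=
  ⟨contDiff_const, ‖c‖, fun _ => le_rfl, fun y => by simp⟩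

theorem CB1.add {u v : E2 → ℝ} (hu : CB1 u) (hv : CB1 v) : CB1 (fun y => u y + v y) := by
  obtain ⟨C, h1, h2⟩ := hu.bdd
  obtain ⟨C', h1', h2'⟩ := hv.bdd
  refine ⟨hu.contDiff.add hv.contDiff, C + C', fun y => ?_, fun y => ?_⟩
  · exact (norm_add_le _ _).trans (add_le_add (h1 y) (h1' y))
  · rw [fderiv_fun_add (hu.contDiff.differentiable (by norm_num) y)
      (hv.contDiff.differentiable (by norm_num) y)]
    exact (norm_add_le _ _).trans (add_le_add (h2 y) (h2' y))

theorem CB1.mul {u v : E2 → ℝ} (hu : CB1 u) (hv : CB1 v) : CB1 (fun y => u y * v y) := by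
  obtain ⟨C, h1, h2⟩ := hu.bdd
  obtain ⟨C', h1', h2'⟩ := hv.bdd
  have hC : 0 ≤ C := (norm_nonneg _).trans (h1 0)
  have hC' : 0 ≤ C' := (norm_nonneg _).trans (h1' 0)
  refine ⟨hu.contDiff.mul hv.contDiff, C * C' + C' * C, fun y => ?_, fun y => ?_⟩
  · rw [norm_mul]
    have := mul_le_mul (h1 y) (h1' y) (norm_nonneg _) hC
    have := mul_nonneg hC' hC
    linarith
  · rw [fderiv_fun_mul (hu.contDiff.differentiable (by norm_num) y)
      (hv.contDiff.differentiable (by norm_num) y)]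
    refine (norm_add_le _ _).trans (add_le_add ?_ ?_)
    · rw [norm_smul]
      exact mul_le_mul (h1 y) (h2' y) (norm_nonneg _) hC
    · rw [norm_smul]
      exact mul_le_mul (h1' y) (h2 y) (norm_nonneg _) hC'

theorem CB1.sub {u v : E2 → ℝ} (hu : CB1 u) (hv : CB1 v) : CB1 (fun y => u y - v y) := by
  have := hu.add ((CB1.const (-1)).mul hv)
  have h2 : (fun y => u y - v y) = fun y => u y + (-1) * v y := by funext y; ring
  rw [h2]; exact this

theorem CB1.sum {α : Type*} (s : Finset α) {u : α → E2 → ℝ} (hu : ∀ a, CB1 (u a)) :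
    CB1 (fun y => ∑ a ∈ s, u a y) := by
  classical
  induction s using Finset.induction_on with
  | empty => simpa using CB1.const 0
  | insert a s ha ih => simpa only [Finset.sum_insert ha] using (hu a).add ih

theorem CB1.prod {α : Type*} (s : Finset α) {u : α → E2 → ℝ} (hu : ∀ a, CB1 (u a)) :
    CB1 (fun y => ∏ a ∈ s, u a y) := by
  classical
  induction s using Finset.induction_on with
  | empty => simpa using CB1.const 1
  | insert a s ha ih => simpa only [Finset.prod_insert ha] using (hu a).mul ih

theorem CB1.comp {u : E2 → ℝ} (hu : CB1 u) {φ : ℝ → ℝ} (hφ : ContDiff ℝ 1 φ) :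
    CB1 (fun y => φ (u y)) := by
  obtain ⟨C, h1, h2⟩ := hu.bdd
  have hC : 0 ≤ C := (norm_nonneg _).trans (h1 0)
  obtain ⟨A, hA⟩ := (isCompact_Icc (a := -C) (b := C)).exists_bound_of_continuousOn
    hφ.continuous.continuousOn
  obtain ⟨B, hB⟩ := (isCompact_Icc (a := -C) (b := C)).exists_bound_of_continuousOn
    (hφ.continuous_deriv (by norm_num)).continuousOn
  have hmem : ∀ y, u y ∈ Icc (-C) C := fun y => abs_le.1 (h1 y)
  have hB0 : 0 ≤ B := (norm_nonneg _).trans (hB _ (hmem 0))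
  refine ⟨hφ.comp hu.contDiff, max A (B * C), fun y => (hA _ (hmem y)).trans (le_max_left _ _),
    fun y => ?_⟩
  have hd := ((hφ.differentiable (by norm_num) (u y)).hasDerivAt).comp_hasFDerivAt y
    (hu.contDiff.differentiable (by norm_num) y).hasFDerivAt
  have hd' : fderiv ℝ (fun y => φ (u y)) y = deriv φ (u y) • fderiv ℝ u y := hd.fderiv
  rw [hd', norm_smul]
  exact (mul_le_mul (hB _ (hmem y)) (h2 y) (norm_nonneg _) hB0).trans (le_max_right _ _)

theorem CB1.continuous {u : E2 → ℝ} (hu : CB1 u) : Continuous u := hu.contDiff.continuous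

/-- The basic building block. -/
theorem CB1_q {μ : ℝ} (hμ : 0 < μ) (p : E2) :
    CB1 (fun x => ‖x - p‖ ^ 2 / (μ + ‖x - p‖ ^ 2)) := by
  have hq : ContDiff ℝ 1 (fun y : E2 => ‖y - p‖ ^ 2) :=
    (contDiff_id.sub contDiff_const).norm_sq ℝ
  refine ⟨hq.div (contDiff_const.add hq) fun x => by positivity, max 1 (1 / μ + 1),
    fun y => ?_, fun y => ?_⟩
  · refine le_trans ?_ (le_max_left _ _)
    rw [norm_of_nonneg (by positivity), div_le_one (by positivity)]
    linarith
  · refine le_trans ?_ (le_max_right _ _)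
    have hp : μ + ‖y - p‖ ^ 2 ≠ 0 := by positivity
    have h1 : (fun x : E2 => ‖x - p‖ ^ 2 / (μ + ‖x - p‖ ^ 2))
        = fun x => 1 - μ * (μ + ‖x - p‖ ^ 2)⁻¹ := by
      funext x
      have : μ + ‖x - p‖ ^ 2 ≠ 0 := by positivity
      field_simp
      ring
    have h2 := (((hasDerivAt_inv hp).comp_hasFDerivAt y
      ((fderiv_norm_sub_sq p y).const_add μ)).const_mul μ).const_sub 1
    simp only [Function.comp_def] at h2
    rw [h1, h2.fderiv]
    have hr := norm_nonneg (y - p)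
    have hi : ‖innerSL ℝ (y - p)‖ = ‖y - p‖ := innerSL_apply_norm ℝ (y - p)
    have e2 : (2 • innerSL ℝ (y - p)) = (2 : ℝ) • innerSL ℝ (y - p) := by
      rw [two_smul, two_smul]
    rw [norm_neg, norm_smul, norm_smul, e2, norm_smul, hi]
    simp only [norm_neg, norm_inv, norm_pow, Real.norm_eq_abs]
    rw [abs_of_pos hμ, abs_of_pos (show 0 < μ + ‖y - p‖ ^ 2 by positivity),
      abs_of_pos (show (0 : ℝ) < 2 by norm_num)]
    generalize ‖y - p‖ = r at *
    have e1 : μ * (((μ + r ^ 2) ^ 2)⁻¹ * (2 * r)) = (μ * (2 * r)) / (μ + r ^ 2) ^ 2 := by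
      field_simp
    rw [e1, div_le_iff₀ (by positivity)]
    have e3 : (1 / μ + 1) * (μ + r ^ 2) ^ 2 = (1 + r ^ 2 / μ + μ + r ^ 2) * (μ + r ^ 2) := by
      field_simp
      ring
    rw [e3]
    have e4 : 0 ≤ r ^ 2 / μ := by positivity
    have e5 : 2 * r ≤ 1 + r ^ 2 / μ + μ + r ^ 2 := by nlinarith [sq_nonneg (r - 1)]
    have e6 : μ ≤ μ + r ^ 2 := by nlinarith
    calc μ * (2 * r) ≤ (μ + r ^ 2) * (1 + r ^ 2 / μ + μ + r ^ 2) :=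
          mul_le_mul e6 e5 (by positivity) (by positivity)
      _ = _ := by ring

theorem CB1_f {l : ℕ} (D : PlanarVortexData l) (j : Fin l) : CB1 (D.f j) :=
  CB1.prod Finset.univ fun k => CB1_q D.μ_pos (D.p j k)

theorem CB1_g {l : ℕ} (D : PlanarVortexData l) (j : Fin l) : CB1 (D.g j) := by
  refine CB1.sum Finset.univ (u := fun k x => 4 * D.μ / (D.μ + ‖x - D.p j k‖ ^ 2) ^ 2) fun k => ?_
  have h := (CB1.const 1).sub (CB1_q D.μ_pos (D.p j k))
  have h2 := (CB1.const (4 / D.μ)).mul (h.mul h)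
  convert h2 using 2 with x
  have := D.μ_pos
  have : D.μ + ‖x - D.p j k‖ ^ 2 ≠ 0 := by positivity
  field_simp
  ring

theorem f_nonneg {l : ℕ} (D : PlanarVortexData l) (j : Fin l) (x : E2) : 0 ≤ D.f j x := by
  have := D.μ_pos
  exact Finset.prod_nonneg fun k _ => by positivity

theorem f_le_one {l : ℕ} (D : PlanarVortexData l) (j : Fin l) (x : E2) : D.f j x ≤ 1 := by
  have := D.μ_pos
  refine Finset.prod_le_one (fun k _ => by positivity) fun k _ => ?_
  rw [div_le_one (by positivity)]
  linarith

theorem g_nonneg {l : ℕ} (D : PlanarVortexData l) (j : Fin l) (x : E2) : 0 ≤ D.g j x := by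
  have := D.μ_pos
  exact Finset.sum_nonneg fun k _ => by positivity

/-! ### Limits of resolvents -/

theorem Res_CB1 {lam : ℝ} (hl : 0 < lam) {k : E2 → ℝ} (hk : CB1 k) : CB1 (Res lam k) := by
  obtain ⟨C, h1, h2⟩ := hk.bdd
  obtain ⟨K, hK, hKb⟩ := ResD_bound lam hl
  refine ⟨(Res_contDiff hl hk).of_le (by norm_num), max (C / lam) (K * C), fun y =>
    (Res_bound hl h1 y).trans (le_max_left _ _), fun y => ?_⟩
  rw [(Res_hasFDerivAt hl hk y).fderiv]
  exact (hKb _ _ h1 y).trans (le_max_right _ _)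

theorem ResD_sub {lam : ℝ} (hl : 0 < lam) {h k : E2 → ℝ} {C C' : ℝ}
    (hc : Continuous h) (hb : ∀ y, ‖h y‖ ≤ C) (kc : Continuous k) (kb : ∀ y, ‖k y‖ ≤ C') (x : E2) :
    ResD lam (fun y => h y - k y) x = ResD lam h x - ResD lam k x := by
  refine clm_ext_E2 fun i => ?_
  rw [sub_apply]
  simp only [ResD_single]
  exact J_sub (wD_integrable hl i) hc hb kc kb x

theorem Res_limit {lam : ℝ} (hl : 0 < lam) {k : E2 → ℝ} (hkc : Continuous k) {C : ℝ}
    (hkb : ∀ y, ‖k y‖ ≤ C) {kn : ℕ → E2 → ℝ} (hkn : ∀ n, CB1 (kn n)) {δ : ℕ → ℝ}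
    (hδ : Tendsto δ atTop (nhds 0)) (hlim : ∀ n y, ‖k y - kn n y‖ ≤ δ n) :
    CB1 (Res lam k) ∧ ∀ x, Tendsto (fun n => Res lam (kn n) x) atTop (nhds (Res lam k x)) := by
  obtain ⟨K, hK, hKb⟩ := ResD_bound lam hl
  have hδ0 : ∀ n, 0 ≤ δ n := fun n => (norm_nonneg _).trans (hlim n 0)
  have hp : ∀ x, Tendsto (fun n => Res lam (kn n) x) atTop (nhds (Res lam k x)) := by
    intro x
    rw [tendsto_iff_norm_sub_tendsto_zero]
    refine squeeze_zero (fun n => norm_nonneg _) (g := fun n => δ n / lam) (fun n => ?_)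
      (by simpa using hδ.div_const lam)
    obtain ⟨C', h1, h2⟩ := (hkn n).bdd
    rw [norm_sub_rev]
    have e := J_sub (wR_integrable hl) hkc hkb (hkn n).continuous h1 x
    unfold Res
    rw [← e]
    exact Res_bound hl (hlim n) x
  have hu : TendstoUniformly (fun n => ResD lam (kn n)) (ResD lam k) atTop := by
    rw [Metric.tendstoUniformly_iff]
    intro ε hε
    have ht : Tendsto (fun n => K * δ n) atTop (nhds 0) := by simpa using hδ.const_mul K
    filter_upwards [ht.eventually (gt_mem_nhds hε)] with n hn x
    obtain ⟨C', h1, h2⟩ := (hkn n).bdd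
    rw [dist_eq_norm, ← ResD_sub hl hkc hkb (hkn n).continuous h1 x]
    exact (hKb _ _ (hlim n) x).trans_lt hn
  have hd : ∀ x, HasFDerivAt (Res lam k) (ResD lam k x) x :=
    hasFDerivAt_of_tendstoUniformly hu (fun n x => Res_hasFDerivAt hl (hkn n) x) hp
  refine ⟨⟨?_, max (C / lam) (K * C), fun y =>
    (Res_bound hl hkb y).trans (le_max_left _ _), fun y => ?_⟩, hp⟩
  · rw [contDiff_one_iff_fderiv]
    refine ⟨fun x => (hd x).differentiableAt, ?_⟩
    have : fderiv ℝ (Res lam k) = ResD lam k := by funext x; exact (hd x).fderiv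
    rw [this]
    unfold ResD
    exact continuous_finsetSum _ fun i _ =>
      (J_continuous (wD_integrable hl i) hkc hkb).smul continuous_const
  · rw [(hd y).fderiv]
    exact (hKb _ _ hkb y).trans (le_max_right _ _)

/-! ### The truncated exponential -/

/-- The exponential, continued linearly (in a `C¹` manner) above `C`. -/
def Ex (C s : ℝ) : ℝ := Real.exp C + ∫ t in C..s, Real.exp (min t C)

theorem Ex_hasDerivAt (C s : ℝ) : HasDerivAt (Ex C) (Real.exp (min s C)) s := by
  have hc : Continuous (fun t => Real.exp (min t C)) := by fun_prop
  exact (intervalIntegral.integral_hasDerivAt_right (hc.intervalIntegrable _ _)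
    (hc.stronglyMeasurableAtFilter _ _) hc.continuousAt).const_add _

theorem Ex_eq {C s : ℝ} (h : s ≤ C) : Ex C s = Real.exp s := by
  unfold Ex
  have : ∫ t in C..s, Real.exp (min t C) = ∫ t in C..s, Real.exp t := by
    refine intervalIntegral.integral_congr fun t ht => ?_
    rw [uIcc_of_ge h] at ht
    simp only [min_eq_left ht.2]
  rw [this, integral_exp]
  ring

theorem Ex_contDiff (C : ℝ) : ContDiff ℝ 1 (Ex C) := by
  rw [contDiff_one_iff_deriv]
  refine ⟨fun s => (Ex_hasDerivAt C s).differentiableAt, ?_⟩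
  have : deriv (Ex C) = fun s => Real.exp (min s C) := by
    funext s; exact (Ex_hasDerivAt C s).deriv
  rw [this]
  fun_prop

theorem Ex_mono (C : ℝ) : Monotone (Ex C) :=
  monotone_of_deriv_nonneg (fun s => (Ex_hasDerivAt C s).differentiableAt) fun s => by
    rw [(Ex_hasDerivAt C s).deriv]; positivity

theorem Ex_nonneg (C s : ℝ) : 0 ≤ Ex C s := by
  rcases le_total s C with h | h
  · rw [Ex_eq h]; positivity
  · refine le_trans ?_ (Ex_mono C h)
    rw [Ex_eq le_rfl]; positivity

theorem Ex_slope_lt (C : ℝ) {a b : ℝ} (hab : b < a) : ∃ c, Real.exp (min b C) ≤ c ∧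
    c ≤ Real.exp C ∧ Ex C a - Ex C b = c * (a - b) := by
  obtain ⟨ξ, hξ, h⟩ := exists_hasDerivAt_eq_slope (Ex C) (fun s => Real.exp (min s C)) hab
    (Ex_contDiff C).continuous.continuousOn (fun s _ => Ex_hasDerivAt C s)
  refine ⟨Real.exp (min ξ C), ?_, ?_, ?_⟩
  · exact Real.exp_le_exp.2 (min_le_min_right _ hξ.1.le)
  · exact Real.exp_le_exp.2 (min_le_right _ _)
  · rw [h]
    have : a - b ≠ 0 := by linarith
    field_simp

theorem Ex_slope (C a b : ℝ) : ∃ c, Real.exp (min (min a b) C) ≤ c ∧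
    c ≤ Real.exp C ∧ Ex C a - Ex C b = c * (a - b) := by
  rcases lt_trichotomy a b with h | h | h
  · obtain ⟨c, h1, h2, h3⟩ := Ex_slope_lt C h
    exact ⟨c, by rwa [min_eq_left h.le], h2, by linarith⟩
  · subst h
    exact ⟨Real.exp C, Real.exp_le_exp.2 (min_le_right _ _), le_rfl, by simp⟩
  · obtain ⟨c, h1, h2, h3⟩ := Ex_slope_lt C h
    exact ⟨c, by rwa [min_eq_right h.le], h2, h3⟩

end

open MeasureTheory Real Set Filter

noncomputable section

/-! ### Auxiliary logarithmic functions -/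

/-- `b_j^η`. -/
def bf {l : ℕ} (D : PlanarVortexData l) (j : Fin l) (η : ℝ) (x : E2) : ℝ :=
  ∑ k, (Real.log (η + ‖x - D.p j k‖ ^ 2) - Real.log (D.μ + ‖x - D.p j k‖ ^ 2))

/-- The concentrated part of the Laplacian of `b_j^η`. -/
def qs {l : ℕ} (D : PlanarVortexData l) (j : Fin l) (η : ℝ) (x : E2) : ℝ :=
  ∑ k, 4 * η / (η + ‖x - D.p j k‖ ^ 2) ^ 2

theorem bf_contDiff {l : ℕ} (D : PlanarVortexData l) (j : Fin l) {η : ℝ} (hη : 0 < η) :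
    ContDiff ℝ 2 (bf D j η) :=
  ContDiff.sum fun k _ => (contDiff_log_add hη (D.p j k)).sub (contDiff_log_add D.μ_pos (D.p j k))

theorem bf_lap {l : ℕ} (D : PlanarVortexData l) (j : Fin l) {η : ℝ} (hη : 0 < η) (x : E2) :
    lap (bf D j η) x = qs D j η x - D.g j x := by
  unfold bf qs PlanarVortexData.g
  rw [lap_sum Finset.univ (u := fun k y => Real.log (η + ‖y - D.p j k‖ ^ 2)
    - Real.log (D.μ + ‖y - D.p j k‖ ^ 2)) (fun k => (contDiff_log_add hη (D.p j k)).sub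
    (contDiff_log_add D.μ_pos (D.p j k))) x, ← Finset.sum_sub_distrib]
  refine Finset.sum_congr rfl fun k _ => ?_
  rw [lap_sub (contDiff_log_add hη (D.p j k)) (contDiff_log_add D.μ_pos (D.p j k)),
    lap_log_add hη, lap_log_add D.μ_pos]

theorem log_diff_le {a b t : ℝ} (ha : 0 < a) (hb : 0 < b) (ht : 0 ≤ t) :
    Real.log (a + t) - Real.log (b + t) ≤ a / b := by
  rw [← Real.log_div (by positivity) (by positivity)]
  refine (Real.log_le_sub_one_of_pos (by positivity)).trans ?_
  have : (a + t) / (b + t) - 1 = (a - b) / (b + t) := by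
    have : b + t ≠ 0 := by positivity
    field_simp; ring
  rw [this, div_le_div_iff₀ (by positivity) hb]
  nlinarith [mul_nonneg ha.le ht]

theorem bf_bound {l : ℕ} (D : PlanarVortexData l) (j : Fin l) {η : ℝ} (hη : 0 < η) :
    ∃ B, 0 ≤ B ∧ ∀ x, |bf D j η x| ≤ B := by
  have hμ := D.μ_pos
  refine ⟨∑ k : Fin (D.N j), (η / D.μ + D.μ / η), Finset.sum_nonneg fun k _ => by positivity,
    fun x => (Finset.abs_sum_le_sum_abs _ _).trans (Finset.sum_le_sum fun k _ => ?_)⟩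
  have h1 := log_diff_le hη hμ (sq_nonneg ‖x - D.p j k‖)
  have h2 := log_diff_le hμ hη (sq_nonneg ‖x - D.p j k‖)
  have h3 : 0 ≤ η / D.μ := by positivity
  have h4 : 0 ≤ D.μ / η := by positivity
  rw [abs_le]
  constructor <;> linarith

theorem qs_nonneg {l : ℕ} (D : PlanarVortexData l) (j : Fin l) {η : ℝ} (hη : 0 < η) (x : E2) :
    0 ≤ qs D j η x := Finset.sum_nonneg fun k _ => by positivity

theorem qs_near {l : ℕ} (D : PlanarVortexData l) (j : Fin l) {η : ℝ} (hη : 0 < η) (x : E2)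
    (k : Fin (D.N j)) (hk : ‖x - D.p j k‖ ^ 2 ≤ η) : 1 / η ≤ qs D j η x := by
  have h1 : 4 * η / (η + ‖x - D.p j k‖ ^ 2) ^ 2 ≤ qs D j η x :=
    Finset.single_le_sum (f := fun k => 4 * η / (η + ‖x - D.p j k‖ ^ 2) ^ 2)
      (fun i _ => by positivity) (Finset.mem_univ k)
  refine le_trans ?_ h1
  rw [div_le_div_iff₀ hη (by positivity)]
  have := sq_nonneg ‖x - D.p j k‖
  nlinarith

theorem qs_le {l : ℕ} (D : PlanarVortexData l) (j : Fin l) {η : ℝ} (hη : 0 < η) (x : E2) :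
    qs D j η x ≤ D.N j * (4 / η) := by
  have : ∑ k : Fin (D.N j), 4 / η = D.N j * (4 / η) := by simp
  rw [← this]
  refine Finset.sum_le_sum fun k _ => ?_
  rw [div_le_div_iff₀ (by positivity) hη]
  have := sq_nonneg ‖x - D.p j k‖
  nlinarith

theorem f_far {l : ℕ} (D : PlanarVortexData l) (j : Fin l) {η : ℝ} (hη : 0 < η) (x : E2)
    (h : ∀ k, η ≤ ‖x - D.p j k‖ ^ 2) : (η / (D.μ + η)) ^ D.N j ≤ D.f j x := by
  have hμ := D.μ_pos
  have : ∏ k : Fin (D.N j), (η / (D.μ + η)) = (η / (D.μ + η)) ^ D.N j := by rw [Finset.prod_const]; simp only [Finset.card_univ, Fintype.card_fin]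
  rw [← this]
  refine Finset.prod_le_prod (fun k _ => by positivity) fun k _ => ?_
  have := h k
  rw [div_le_div_iff₀ (by positivity) (by positivity)]
  nlinarith

theorem f_far' {l : ℕ} (D : PlanarVortexData l) {η : ℝ} (hη : 0 < η) :
    ∃ θ, 0 < θ ∧ θ ≤ 1 ∧ ∀ j x, (∀ k, η ≤ ‖x - D.p j k‖ ^ 2) → θ ≤ D.f j x := by
  have hμ := D.μ_pos
  have h0 : 0 < η / (D.μ + η) := by positivity
  have h1 : η / (D.μ + η) ≤ 1 := by rw [div_le_one (by positivity)]; linarith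
  refine ⟨(η / (D.μ + η)) ^ (∑ j, D.N j), by positivity, pow_le_one₀ h0.le h1,
    fun j x h => (pow_le_pow_of_le_one h0.le h1 ?_).trans (f_far D j hη x h)⟩
  exact Finset.single_le_sum (f := D.N) (fun i _ => Nat.zero_le _) (Finset.mem_univ j)

theorem g_bound {l : ℕ} (D : PlanarVortexData l) :
    ∃ G, 0 ≤ G ∧ ∀ x, ∑ j, D.g j x ≤ G := by
  obtain ⟨C, h1, h2⟩ := (CB1.sum Finset.univ (CB1_g D)).bdd
  exact ⟨C, (norm_nonneg _).trans (h1 0), fun x => (le_abs_self _).trans (h1 x)⟩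

/-! ### The nonlinearity -/

/-- The inhomogeneous term `h_j`. -/
def hh {l : ℕ} (D : PlanarVortexData l) (j : Fin l) (x : E2) : ℝ :=
  D.g j x - (∑ i, D.g i x) / (l + 1)

/-- `F_j` for `j` in `1..l`. -/
def Fj {l : ℕ} (D : PlanarVortexData l) (C : ℝ) (j : Fin l) (x : E2)
    (ξ : Option (Fin l) → ℝ) : ℝ :=
  D.f j x * Ex C (ξ (some j) - ξ none) - 1 + hh D j x

/-- The nonlinearity `F_a`. -/
def Fa {l : ℕ} (D : PlanarVortexData l) (C : ℝ) : Option (Fin l) → E2 →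
    (Option (Fin l) → ℝ) → ℝ
  | some j => Fj D C j
  | none => fun x ξ => - ∑ j, Fj D C j x ξ

theorem hh_add_sum {l : ℕ} (D : PlanarVortexData l) (j : Fin l) (x : E2) :
    hh D j x + ∑ i, hh D i x = D.g j x := by
  unfold hh
  rw [Finset.sum_sub_distrib]
  simp only [Finset.sum_const, Finset.card_univ, Fintype.card_fin, nsmul_eq_mul]
  field_simp
  ring

theorem Fa_sum {l : ℕ} (D : PlanarVortexData l) (C : ℝ) (x : E2) (ξ : Option (Fin l) → ℝ) :
    ∑ a, Fa D C a x ξ = 0 := by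
  rw [Fintype.sum_option]
  simp [Fa]

theorem Fa_diff {l : ℕ} (D : PlanarVortexData l) (C : ℝ) (j : Fin l) (x : E2)
    (ξ : Option (Fin l) → ℝ) :
    Fa D C (some j) x ξ - Fa D C none x ξ = D.f j x * Ex C (ξ (some j) - ξ none)
      + ∑ i, D.f i x * Ex C (ξ (some i) - ξ none) - (l + 1) + D.g j x := by
  rw [← hh_add_sum]
  simp only [Fa, Fj, Finset.sum_add_distrib, Finset.sum_sub_distrib]
  simp
  ring

theorem hh_CB1 {l : ℕ} (D : PlanarVortexData l) (j : Fin l) : CB1 (hh D j) := by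
  have := (CB1_g D j).sub ((CB1.sum Finset.univ (CB1_g D)).mul (CB1.const (1 / ((l : ℝ) + 1))))
  convert this using 2 with x
  unfold hh
  ring

theorem Fa_CB1 {l : ℕ} (D : PlanarVortexData l) (C : ℝ) (a : Option (Fin l))
    {w : Option (Fin l) → E2 → ℝ} (hw : ∀ a, CB1 (w a)) :
    CB1 (fun x => Fa D C a x (fun a => w a x)) := by
  have hj : ∀ j, CB1 (fun x => Fj D C j x (fun a => w a x)) := fun j =>
    (((CB1_f D j).mul (((hw (some j)).sub (hw none)).comp (Ex_contDiff C))).sub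
      (CB1.const 1)).add (hh_CB1 D j)
  cases a with
  | some j => exact hj j
  | none =>
    have := (CB1.const (-1)).mul (CB1.sum Finset.univ hj)
    convert this using 2 with x
    simp [Fa]

/-- Slopes of the nonlinearity. -/
theorem Fa_slope {l : ℕ} (D : PlanarVortexData l) (C : ℝ) (x : E2) (ξ ζ : Option (Fin l) → ℝ) :
    ∃ c : Fin l → ℝ, (∀ j, Real.exp (min (min (ξ (some j) - ξ none) (ζ (some j) - ζ none)) C)
        * D.f j x ≤ c j) ∧ (∀ j, 0 ≤ c j) ∧ (∀ j, c j ≤ Real.exp C) ∧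
      (∀ j, Fa D C (some j) x ξ - Fa D C (some j) x ζ =
        c j * ((ξ (some j) - ζ (some j)) - (ξ none - ζ none))) ∧
      Fa D C none x ξ - Fa D C none x ζ =
        - ∑ j, c j * ((ξ (some j) - ζ (some j)) - (ξ none - ζ none)) := by
  choose c h1 h2 h3 using fun j : Fin l => Ex_slope C (ξ (some j) - ξ none) (ζ (some j) - ζ none)
  have h0 : ∀ j, 0 ≤ c j := fun j => (Real.exp_pos _).le.trans (h1 j)
  have key : ∀ j, Fj D C j x ξ - Fj D C j x ζ =
        (c j * D.f j x) * ((ξ (some j) - ζ (some j)) - (ξ none - ζ none)) := by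
    intro j
    have := h3 j
    unfold Fj
    linear_combination (D.f j x) * this
  refine ⟨fun j => c j * D.f j x, fun j => ?_, fun j => ?_, fun j => ?_, key, ?_⟩
  · exact mul_le_mul_of_nonneg_right (h1 j) (f_nonneg D j x)
  · exact mul_nonneg (h0 j) (f_nonneg D j x)
  · have := mul_le_mul (h2 j) (f_le_one D j x) (f_nonneg D j x) (Real.exp_pos C).le
    linarith
  · simp only [Fa]
    rw [← Finset.sum_congr rfl fun j _ => key j, Finset.sum_sub_distrib]
    ring

end

open MeasureTheory Real Set Filter
open scoped BoundedContinuousFunction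

noncomputable section

/-! ### The regularised problem -/

/-- `κ ξ_a - F_a`. -/
def Hk {l : ℕ} (D : PlanarVortexData l) (C κ : ℝ) (a : Option (Fin l)) (x : E2)
    (ξ : Option (Fin l) → ℝ) : ℝ := κ * ξ a - Fa D C a x ξ

theorem Hk_lip {l : ℕ} (D : PlanarVortexData l) {C κ : ℝ} (hκ : l * Real.exp C ≤ κ)
    (a : Option (Fin l)) (x : E2) {ξ ζ : Option (Fin l) → ℝ} {d : ℝ}
    (h : ∀ a, |ξ a - ζ a| ≤ d) : |Hk D C κ a x ξ - Hk D C κ a x ζ| ≤ κ * d := by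
  obtain ⟨c, -, h0, h1, h2, h3⟩ := Fa_slope D C x ξ ζ
  have hd : 0 ≤ d := (abs_nonneg _).trans (h none)
  have hn := abs_le.1 (h none)
  cases a with
  | some j =>
    have hcj : c j ≤ κ := by
      have hl : (1 : ℝ) ≤ l := by exact_mod_cast j.pos
      have := Real.exp_pos C
      have := h1 j
      nlinarith
    have e : Hk D C κ (some j) x ξ - Hk D C κ (some j) x ζ
        = (κ - c j) * (ξ (some j) - ζ (some j)) + c j * (ξ none - ζ none) := by
      unfold Hk
      linear_combination - h2 j
    rw [e]
    refine (abs_add_le _ _).trans ?_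
    rw [abs_mul, abs_mul, abs_of_nonneg (sub_nonneg.2 hcj), abs_of_nonneg (h0 j)]
    have := mul_le_mul_of_nonneg_left (h (some j)) (sub_nonneg.2 hcj)
    have := mul_le_mul_of_nonneg_left (h none) (h0 j)
    linarith
  | none =>
    have hs : ∑ j, c j ≤ κ := by
      refine le_trans ?_ hκ
      have := Finset.sum_le_sum (s := Finset.univ) fun j _ => h1 j
      simpa using this
    have e : Hk D C κ none x ξ - Hk D C κ none x ζ
        = (κ - ∑ j, c j) * (ξ none - ζ none) + ∑ j, c j * (ξ (some j) - ζ (some j)) := by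
      unfold Hk
      have : ∑ j, c j * ((ξ (some j) - ζ (some j)) - (ξ none - ζ none))
        = ∑ j, c j * (ξ (some j) - ζ (some j)) - (∑ j, c j) * (ξ none - ζ none) := by
        rw [Finset.sum_mul, ← Finset.sum_sub_distrib]
        exact Finset.sum_congr rfl fun j _ => by ring
      linear_combination - h3 + this
    rw [e]
    refine (abs_add_le _ _).trans ?_
    rw [abs_mul, abs_of_nonneg (sub_nonneg.2 hs)]
    have t1 := mul_le_mul_of_nonneg_left (h none) (sub_nonneg.2 hs)
    have t2 : |∑ j, c j * (ξ (some j) - ζ (some j))| ≤ (∑ j, c j) * d := by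
      refine (Finset.abs_sum_le_sum_abs _ _).trans ?_
      rw [Finset.sum_mul]
      refine Finset.sum_le_sum fun j _ => ?_
      rw [abs_mul, abs_of_nonneg (h0 j)]
      exact mul_le_mul_of_nonneg_left (h (some j)) (h0 j)
    linarith

theorem Hk_CB1 {l : ℕ} (D : PlanarVortexData l) (C κ : ℝ) (a : Option (Fin l))
    {w : Option (Fin l) → E2 → ℝ} (hw : ∀ a, CB1 (w a)) :
    CB1 (fun x => Hk D C κ a x (fun a => w a x)) :=
  ((CB1.const κ).mul (hw a)).sub (Fa_CB1 D C a hw)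

theorem Hk_continuous {l : ℕ} (D : PlanarVortexData l) (C κ : ℝ) (a : Option (Fin l))
    {w : E2 → Option (Fin l) → ℝ} (hw : Continuous w) :
    Continuous (fun x => Hk D C κ a x (w x)) := by
  have hwa : ∀ a, Continuous (fun x => w x a) := fun a => (continuous_apply a).comp hw
  have hj : ∀ j, Continuous (fun x => Fj D C j x (w x)) := fun j =>
    (((CB1_f D j).continuous.mul ((Ex_contDiff C).continuous.comp
      ((hwa (some j)).sub (hwa none)))).sub continuous_const).add (hh_CB1 D j).continuous
  refine (continuous_const.mul (hwa a)).sub ?_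
  cases a with
  | some j => exact hj j
  | none => exact (continuous_finsetSum _ fun j _ => hj j).neg

theorem Hk_bound {l : ℕ} (D : PlanarVortexData l) {C κ : ℝ} (hκ : l * Real.exp C ≤ κ) :
    ∃ A, 0 ≤ A ∧ ∀ a (w : E2 → Option (Fin l) → ℝ) M, (∀ x a, |w x a| ≤ M) →
      ∀ x, ‖Hk D C κ a x (w x)‖ ≤ A + κ * M := by
  choose A hA _ using fun a => (Hk_CB1 D C κ a (w := fun _ _ => 0) fun _ => CB1.const 0).bdd
  have hA0 : ∀ a, 0 ≤ A a := fun a => (norm_nonneg _).trans (hA a 0)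
  refine ⟨∑ a, A a, Finset.sum_nonneg fun a _ => hA0 a, fun a w M hM x => ?_⟩
  have h1 := Hk_lip D hκ a x (ξ := w x) (ζ := fun _ => 0) (d := M) (by simpa using hM x)
  have h2 : A a ≤ ∑ a, A a := Finset.single_le_sum (fun i _ => hA0 i) (Finset.mem_univ a)
  have h3 := hA a x
  simp only [Real.norm_eq_abs] at h3 ⊢
  have h4 := abs_sub_abs_le_abs_sub (Hk D C κ a x (w x)) (Hk D C κ a x fun _ => 0)
  linarith

/-- The fixed point map. -/
theorem exists_map {l : ℕ} (D : PlanarVortexData l) {C κ lam : ℝ} (hκ : l * Real.exp C ≤ κ)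
    (hlam : 0 < lam) :
    ∃ Φ : (E2 →ᵇ (Option (Fin l) → ℝ)) → (E2 →ᵇ (Option (Fin l) → ℝ)),
      ∀ w x a, Φ w x a = Res lam (fun y => Hk D C κ a y (w y)) x := by
  obtain ⟨A, hA0, hA⟩ := Hk_bound D hκ
  have hκ0 : 0 ≤ κ := le_trans (by positivity) hκ
  have hM : ∀ w : E2 →ᵇ (Option (Fin l) → ℝ), ∀ x a, |w x a| ≤ ‖w‖ := fun w x a =>
    (norm_le_pi_norm (w x) a).trans (w.norm_coe_le_norm x)
  refine ⟨fun w => BoundedContinuousFunction.ofNormedAddCommGroup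
    (fun x a => Res lam (fun y => Hk D C κ a y (w y)) x) ?_ ((A + κ * ‖w‖) / lam) ?_,
    fun w x a => rfl⟩
  · exact continuous_pi fun a => J_continuous (wR_integrable hlam)
      (Hk_continuous D C κ a w.continuous) (hA a w _ (hM w))
  · intro x
    refine (pi_norm_le_iff_of_nonneg (by positivity)).2 fun a => ?_
    exact Res_bound hlam (hA a w _ (hM w)) x

theorem eps_solution {l : ℕ} (D : PlanarVortexData l) {C κ lam : ℝ} (hκ : l * Real.exp C ≤ κ)
    (hlam : 0 < lam) (hkl : κ < lam) :
    ∃ w : Option (Fin l) → E2 → ℝ, (∀ a, CB1 (w a)) ∧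
      (∀ a x, w a x = Res lam (fun y => Hk D C κ a y (fun b => w b y)) x) := by
  obtain ⟨Φ, hΦ⟩ := exists_map D hκ hlam
  have hκ0 : 0 ≤ κ := le_trans (by positivity) hκ
  obtain ⟨A, hA0, hA⟩ := Hk_bound D hκ
  have hM : ∀ w : E2 →ᵇ (Option (Fin l) → ℝ), ∀ x a, |w x a| ≤ ‖w‖ := fun w x a =>
    (norm_le_pi_norm (w x) a).trans (w.norm_coe_le_norm x)
  have hdist : ∀ u w : E2 →ᵇ (Option (Fin l) → ℝ), ∀ x a, |u x a - w x a| ≤ dist u w :=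
    fun u w x a => by
      have h1 := u.dist_coe_le_dist (g := w) x
      have h2 := dist_le_pi_dist (u x) (w x) a
      rw [Real.dist_eq] at h2
      exact h2.trans h1
  have hcon : ContractingWith ⟨κ / lam, by positivity⟩ Φ := by
    refine ⟨?_, LipschitzWith.of_dist_le_mul fun u w => ?_⟩
    · exact (NNReal.coe_lt_coe (r₁ := ⟨κ / lam, by positivity⟩) (r₂ := 1)).1
        ((div_lt_one hlam).2 hkl)
    · have h0 : 0 ≤ κ / lam * dist u w := by positivity
      refine (BoundedContinuousFunction.dist_le h0).2 fun x => ?_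
      refine (dist_pi_le_iff h0).2 fun a => ?_
      rw [hΦ, hΦ, dist_eq_norm]
      have e := J_sub (wR_integrable hlam) (Hk_continuous D C κ a u.continuous)
        (hA a u _ (hM u)) (Hk_continuous D C κ a w.continuous) (hA a w _ (hM w)) x
      unfold Res
      rw [← e]
      have := Res_bound hlam (h := fun y => Hk D C κ a y (u y) - Hk D C κ a y (w y))
        (C := κ * dist u w) (fun y => Hk_lip D hκ a y (hdist u w y)) x
      calc _ ≤ _ := this
        _ = _ := by ring
  set w := hcon.fixedPoint with hw
  have hfix : Φ w = w := hcon.fixedPoint_isFixedPt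
  have hit : ∀ n a, CB1 (fun x => (Φ^[n] 0) x a) := by
    intro n
    induction n with
    | zero => intro a; exact CB1.const 0
    | succ n ih =>
      intro a
      rw [Function.iterate_succ_apply']
      have : (fun x => (Φ (Φ^[n] 0)) x a) = Res lam (fun y => Hk D C κ a y ((Φ^[n] 0) y)) := by
        funext x; exact hΦ _ _ _
      rw [this]
      exact Res_CB1 hlam (Hk_CB1 D C κ a ih)
  have hten : Tendsto (fun n => κ * dist w (Φ^[n] 0)) atTop (nhds 0) := by
    have h1 := hcon.tendsto_iterate_fixedPoint 0
    have h2 := (tendsto_const_nhds (x := w)).dist h1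
    rw [← hw, dist_self] at h2
    simpa using h2.const_mul κ
  have heq : ∀ a x, w x a = Res lam (fun y => Hk D C κ a y (w y)) x := by
    intro a x
    rw [← hΦ, hfix]
  refine ⟨fun a x => w x a, fun a => ?_, fun a x => heq a x⟩
  have := (Res_limit hlam (Hk_continuous D C κ a w.continuous) (hA a w _ (hM w))
    (fun n => Hk_CB1 D C κ a (hit n)) hten (fun n y => Hk_lip D hκ a y (hdist w _ y))).1
  have e : (fun x => w x a) = Res lam (fun y => Hk D C κ a y (w y)) := by
    funext x; exact heq a x
  show CB1 (fun x => w x a)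
  rw [e]
  exact this

/-- A solution of the `ε`-regularised system. -/
structure EpsSol {l : ℕ} (D : PlanarVortexData l) (C ε : ℝ) (w : Option (Fin l) → E2 → ℝ) :
    Prop where
  contDiff : ∀ a, ContDiff ℝ 2 (w a)
  bdd : ∃ M, ∀ a x, |w a x| ≤ M
  eqn : ∀ a x, lap (w a) x = Fa D C a x (fun b => w b x) + ε * w a x
  sum : ∀ x, ∑ a, w a x = 0

theorem solution_of_Res {l : ℕ} (D : PlanarVortexData l) {C κ lam : ℝ} (hlam : 0 < lam)
    {w : Option (Fin l) → E2 → ℝ} (hw : ∀ a, CB1 (w a))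
    (h : ∀ a x, w a x = Res lam (fun y => Hk D C κ a y (fun b => w b y)) x) :
    (∀ a, ContDiff ℝ 2 (w a)) ∧ (∃ M, ∀ a x, |w a x| ≤ M) ∧
    ∀ a x, lap (w a) x = Fa D C a x (fun b => w b x) + (lam - κ) * w a x := by
  have e : ∀ a, w a = Res lam (fun y => Hk D C κ a y (fun b => w b y)) := fun a => funext (h a)
  refine ⟨fun a => ?_, ?_, fun a x => ?_⟩
  · rw [e a]; exact Res_contDiff hlam (Hk_CB1 D C κ a hw)
  · choose B hB _ using fun a => (hw a).bdd
    exact ⟨∑ a, B a, fun a x => (hB a x).trans (Finset.single_le_sum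
      (fun i _ => (norm_nonneg _).trans (hB i 0)) (Finset.mem_univ a))⟩
  · have h1 := Res_lap hlam (Hk_CB1 D C κ a hw) x
    rw [← e a] at h1
    rw [h1]
    unfold Hk
    ring

theorem sum_zero {l : ℕ} (D : PlanarVortexData l) {C ε : ℝ} (hε : 0 < ε)
    {w : Option (Fin l) → E2 → ℝ} (hc : ∀ a, ContDiff ℝ 2 (w a)) (hM : ∃ M, ∀ a x, |w a x| ≤ M)
    (he : ∀ a x, lap (w a) x = Fa D C a x (fun b => w b x) + ε * w a x) (x : E2) :
    ∑ a, w a x = 0 := by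
  obtain ⟨M, hM⟩ := hM
  set W : E2 → ℝ := fun x => ∑ a, w a x with hW
  have hWc : ContDiff ℝ 2 W := ContDiff.sum fun a _ => hc a
  have hWl : ∀ x, lap W x = ε * W x := by
    intro x
    rw [hW, lap_sum Finset.univ hc x]
    simp only [he, Finset.sum_add_distrib, Fa_sum, ← Finset.mul_sum, zero_add]
  have hWb : ∀ x, |W x| ≤ ∑ a : Option (Fin l), M := fun x =>
    (Finset.abs_sum_le_sum_abs _ _).trans (Finset.sum_le_sum fun a _ => hM a x)
  set B := ∑ a : Option (Fin l), M
  have hs : ∀ s > 0, |W x| ≤ s := by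
    intro s hs
    have hσ : 0 < s / (1 + 1 / ε) := by positivity
    set σ := s / (1 + 1 / ε) with hσd
    have hσs : σ + σ / ε = s := by rw [hσd]; field_simp
    obtain ⟨y, hy, hy2⟩ := global_min_principle hWc (fun x => (abs_le.1 (hWb x)).1) hσ
    obtain ⟨z, hz, hz2⟩ := global_max_principle hWc (fun x => (abs_le.1 (hWb x)).2) hσ
    rw [hWl] at hy2 hz2
    have h1 : -(σ / ε) ≤ W y := by
      rw [← neg_div, div_le_iff₀ hε]; linarith
    have h2 : W z ≤ σ / ε := by
      rw [le_div_iff₀ hε]; linarith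
    rw [abs_le]
    constructor
    · linarith [hy x]
    · linarith [hz x]
  have : |W x| ≤ 0 := le_of_forall_gt_imp_ge_of_dense fun s h => hs s h
  exact abs_nonpos_iff.1 this

end

open MeasureTheory Real Set Filter

noncomputable section

/-! ### A priori bounds -/

theorem EpsSol.lap_v {l : ℕ} {D : PlanarVortexData l} {C ε : ℝ} {w : Option (Fin l) → E2 → ℝ}
    (h : EpsSol D C ε w) (j : Fin l) (x : E2) :
    lap (fun x => w (some j) x - w none x) x = D.f j x * Ex C (w (some j) x - w none x)
      + ∑ i, D.f i x * Ex C (w (some i) x - w none x) - (l + 1) + D.g j x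
      + ε * (w (some j) x - w none x) := by
  rw [lap_sub (h.contDiff _) (h.contDiff _), h.eqn, h.eqn]
  have := Fa_diff D C j x (fun b => w b x)
  linear_combination this

theorem upper_bound {l : ℕ} (D : PlanarVortexData l) : ∃ C, 0 ≤ C ∧ ∀ ε, 0 ≤ ε →
    ∀ w, EpsSol D C ε w → ∀ j x, w (some j) x - w none x ≤ C := by
  have hη : (0 : ℝ) < 1 / (l + 2) := by positivity
  set η : ℝ := 1 / (l + 2) with hηd
  obtain ⟨θ, hθ, hθ1, hf⟩ := f_far' D hη
  choose Bj hBj0 hBj using fun j => bf_bound D j hη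
  set B := ∑ j, Bj j with hB
  have hB0 : 0 ≤ B := Finset.sum_nonneg fun j _ => hBj0 j
  have hBle : ∀ j, Bj j ≤ B := fun j => Finset.single_le_sum (fun i _ => hBj0 i) (Finset.mem_univ j)
  set K : ℝ := (l + 3) / θ with hK
  have hK0 : 0 ≤ K := by positivity
  have hKe : (l : ℝ) + 3 ≤ θ * Real.exp K := by
    have h1 := Real.add_one_le_exp K
    have h2 : θ * K = l + 3 := by rw [hK]; field_simp
    nlinarith
  refine ⟨K + 1 + 2 * B, by positivity, fun ε hε w hw j x => ?_⟩
  set C := K + 1 + 2 * B with hC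
  obtain ⟨M, hM⟩ := hw.bdd
  have hvc : ContDiff ℝ 2 (fun x => w (some j) x - w none x) :=
    (hw.contDiff _).sub (hw.contDiff _)
  have hzc : ContDiff ℝ 2 (fun x => (w (some j) x - w none x) + bf D j η x) :=
    hvc.add (bf_contDiff D j hη)
  have hzb : ∀ x, (w (some j) x - w none x) + bf D j η x ≤ 2 * M + B := fun x => by
    have h1 := abs_le.1 (hM (some j) x)
    have h2 := abs_le.1 (hM none x)
    have h3 := abs_le.1 (hBj j x)
    have := hBle j
    linarith
  obtain ⟨y, hy, hy2⟩ := global_max_principle hzc hzb (show (0 : ℝ) < 1 / 2 by norm_num)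
  rw [lap_add hvc (bf_contDiff D j hη), hw.lap_v, bf_lap D j hη] at hy2
  have hyx := hy x
  have h3 := abs_le.1 (hBj j x)
  have h4 := abs_le.1 (hBj j y)
  have h5 := hBle j
  by_cases hvy : w (some j) y - w none y ≤ K
  · linarith
  · exfalso
    push Not at hvy
    have e1 : 0 ≤ ∑ i, D.f i y * Ex C (w (some i) y - w none y) :=
      Finset.sum_nonneg fun i _ => mul_nonneg (f_nonneg D i y) (Ex_nonneg _ _)
    have e2 : 0 ≤ ε * (w (some j) y - w none y) := mul_nonneg hε (by linarith)
    have e3 := qs_nonneg D j hη y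
    have e4 : 0 ≤ D.f j y * Ex C (w (some j) y - w none y) :=
      mul_nonneg (f_nonneg D j y) (Ex_nonneg _ _)
    by_cases hn : ∃ k, ‖y - D.p j k‖ ^ 2 ≤ η
    · obtain ⟨k, hk⟩ := hn
      have e5 := qs_near D j hη y k hk
      have e6 : 1 / η = l + 2 := by rw [hηd]; field_simp
      linarith
    · push Not at hn
      have e5 := hf j y fun k => (hn k).le
      have e6 : Real.exp K ≤ Ex C (w (some j) y - w none y) := by
        rw [← Ex_eq (C := C) (s := K) (by rw [hC]; linarith)]
        exact Ex_mono C hvy.le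
      have e7 := mul_le_mul e5 e6 (Real.exp_pos K).le (f_nonneg D j y)
      linarith

theorem w_none_lower {l : ℕ} {C : ℝ} (hC : 0 ≤ C) {ξ : Option (Fin l) → ℝ} (hs : ∑ a, ξ a = 0)
    (hv : ∀ j, ξ (some j) - ξ none ≤ C) : -C ≤ ξ none := by
  rw [Fintype.sum_option] at hs
  have h1 := Finset.sum_le_sum (s := Finset.univ) fun j _ => hv j
  rw [Finset.sum_sub_distrib] at h1
  simp only [Finset.sum_const, Finset.card_univ, Fintype.card_fin, nsmul_eq_mul] at h1
  have hl : (0 : ℝ) ≤ l := by positivity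
  by_contra hcon
  push Not at hcon
  nlinarith

theorem abs_of_lower {l : ℕ} {M : ℝ} {ξ : Option (Fin l) → ℝ} (hs : ∑ a, ξ a = 0)
    (hM : ∀ a, -M ≤ ξ a) (a) : |ξ a| ≤ (l + 1) * M := by
  have h1 : ξ a + M ≤ ∑ b, (ξ b + M) :=
    Finset.single_le_sum (f := fun b => ξ b + M) (fun b _ => by linarith [hM b]) (Finset.mem_univ a)
  rw [Finset.sum_add_distrib, hs] at h1
  simp only [Finset.sum_const, Finset.card_univ, Fintype.card_option, Fintype.card_fin,
    nsmul_eq_mul, Nat.cast_add, Nat.cast_one] at h1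
  have h2 := hM a
  have h3 : (0:ℝ) ≤ (l + 1) * M := by
    have : 0 ≤ ∑ b, (ξ b + M) := Finset.sum_nonneg fun b _ => by linarith [hM b]
    rw [Finset.sum_add_distrib, hs] at this
    simpa using this
  have h4 : 0 ≤ M := by
    by_contra hcon
    push Not at hcon
    have hl : (0 : ℝ) ≤ l := by positivity
    nlinarith
  have hl : (0 : ℝ) ≤ l := by positivity
  rw [abs_le]
  constructor <;> nlinarith

theorem full_bound {l : ℕ} (D : PlanarVortexData l) {C : ℝ} (hC : 0 ≤ C) : ∃ M, 0 ≤ M ∧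
    ∀ ε, 0 ≤ ε → ∀ w, EpsSol D C ε w → (∀ j x, w (some j) x - w none x ≤ C) →
      ∀ a x, |w a x| ≤ M := by
  have hη : ∀ j, (0 : ℝ) < 16 * (D.N j + 1) := fun j => by positivity
  choose Bj hBj0 hBj using fun j => bf_bound D j (hη j)
  set B := ∑ j, Bj j with hB
  have hB0 : 0 ≤ B := Finset.sum_nonneg fun j _ => hBj0 j
  have hBle : ∀ j, Bj j ≤ B := fun j => Finset.single_le_sum (fun i _ => hBj0 i) (Finset.mem_univ j)
  refine ⟨(l + 1) * (C + 2 + 2 * B), by positivity, fun ε hε w hw hv a x => ?_⟩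
  refine abs_of_lower (ξ := fun a => w a x) (hw.sum x) (fun a => ?_) a
  obtain ⟨M, hM⟩ := hw.bdd
  cases a with
  | none =>
    have := w_none_lower hC (hw.sum x) (fun j => hv j x)
    linarith
  | some j =>
    have hbc := bf_contDiff D j (hη j)
    have hzc : ContDiff ℝ 2 (fun x => w (some j) x + bf D j (16 * (D.N j + 1)) x) :=
      (hw.contDiff _).add hbc
    have hzb : ∀ x, -(M + B) ≤ w (some j) x + bf D j (16 * (D.N j + 1)) x := fun x => by
      have h1 := abs_le.1 (hM (some j) x)
      have h3 := abs_le.1 (hBj j x)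
      have := hBle j
      linarith
    obtain ⟨y, hy, hy2⟩ := global_min_principle hzc hzb (show (0 : ℝ) < 1 / 4 by norm_num)
    rw [lap_add (hw.contDiff _) hbc, hw.eqn, bf_lap D j (hη j)] at hy2
    simp only [Fa, Fj, hh] at hy2
    have hyx := hy x
    have h3 := abs_le.1 (hBj j x)
    have h4 := abs_le.1 (hBj j y)
    have h5 := hBle j
    have h6 : qs D j (16 * (D.N j + 1)) y ≤ 1 / 4 := by
      refine (qs_le D j (hη j) y).trans ?_
      rw [mul_div_assoc', div_le_div_iff₀ (hη j) (by norm_num)]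
      linarith
    have h7 : 0 ≤ (∑ i, D.g i y) / ((l : ℝ) + 1) :=
      div_nonneg (Finset.sum_nonneg fun i _ => g_nonneg D i y) (by positivity)
    suffices -C - 1 ≤ w (some j) y by linarith
    rcases le_or_gt 0 (w (some j) y) with h0 | h0
    · linarith
    · have h8 : ε * w (some j) y ≤ 0 := mul_nonpos_of_nonneg_of_nonpos hε h0.le
      have h9 : 1 / 2 ≤ D.f j y * Ex C (w (some j) y - w none y) := by linarith
      rw [Ex_eq (hv j y)] at h9
      have h10 : 1 / 2 ≤ Real.exp (w (some j) y - w none y) := by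
        have := mul_le_mul_of_nonneg_right (f_le_one D j y)
          (Real.exp_pos (w (some j) y - w none y)).le
        linarith
      have h11 : Real.exp (-(w (some j) y - w none y)) ≤ 2 := by
        rw [Real.exp_neg, inv_le_comm₀ (Real.exp_pos _) (by norm_num)]
        linarith
      have h12 := Real.add_one_le_exp (-(w (some j) y - w none y))
      have h13 := w_none_lower hC (hw.sum y) (fun j => hv j y)
      linarith

end

open MeasureTheory Real Set Filter

noncomputable section

/-! ### Linear stability -/

theorem family_min {ι : Type*} [Finite ι] [Nonempty ι] {u : ι → E2 → ℝ}
    (hu : ∀ a, ContDiff ℝ 2 (u a)) {M : ℝ} (hM : ∀ a x, M ≤ u a x) {σ : ℝ} (hσ : 0 < σ) :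
    ∃ a y, (∀ b x, u a y ≤ u b x + σ) ∧ -σ ≤ lap (u a) y := by
  obtain ⟨a, ha⟩ := Finite.exists_min (fun a => ⨅ x, u a x)
  have hbdd : ∀ a, BddBelow (range (u a)) := fun a => ⟨M, by rintro _ ⟨x, rfl⟩; exact hM a x⟩
  obtain ⟨y, hy, hy2⟩ := global_min_principle (hu a) (hM a) hσ
  refine ⟨a, y, fun b x => ?_, hy2⟩
  have h1 : u a y - σ ≤ ⨅ x, u a x := le_ciInf fun x => by linarith [hy x]
  have h2 := ha b
  have h3 := ciInf_le (hbdd b) x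
  linarith

theorem core_bound {l : ℕ} {c : Fin l → ℝ} {ξ : Option (Fin l) → ℝ} {m E κ P : ℝ} (hm : 0 < m)
    (hcm : ∀ j, m ≤ c j) (hcE : ∀ j, c j ≤ E) (hκ : 0 ≤ κ) (hd : ∀ j, -κ ≤ ξ (some j) - ξ none)
    (hP : ∑ j, c j * (ξ (some j) - ξ none) ≤ P) (hs : ∑ a, ξ a = 0)
    (hPn : 0 ≤ P) (hE : 0 ≤ E) : -((P + l * E * κ) / m) ≤ ξ none := by
  refine w_none_lower (by positivity) hs fun j => ?_
  have h0 : ∀ j, 0 ≤ c j * (ξ (some j) - ξ none + κ) := fun j =>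
    mul_nonneg (hm.le.trans (hcm j)) (by linarith [hd j])
  have h1 : c j * (ξ (some j) - ξ none + κ) ≤ ∑ j, c j * (ξ (some j) - ξ none + κ) :=
    Finset.single_le_sum (fun i _ => h0 i) (Finset.mem_univ j)
  have h2 : ∑ j, c j * (ξ (some j) - ξ none + κ)
      = ∑ j, c j * (ξ (some j) - ξ none) + (∑ j, c j) * κ := by
    rw [Finset.sum_mul, ← Finset.sum_add_distrib]
    exact Finset.sum_congr rfl fun j _ => by ring
  have h3 : ∑ j, c j ≤ l * E := by
    have := Finset.sum_le_sum (s := Finset.univ) fun j _ => hcE j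
    simpa using this
  have h4 := mul_le_mul_of_nonneg_right h3 hκ
  have h5 : m * (ξ (some j) - ξ none + κ) ≤ c j * (ξ (some j) - ξ none + κ) :=
    mul_le_mul_of_nonneg_right (hcm j) (by linarith [hd j])
  rw [le_div_iff₀ hm]
  nlinarith

/-- An approximate solution of the linearised system. -/
structure LinSol {l : ℕ} (D : PlanarVortexData l) (m E ρ : ℝ) (d : Option (Fin l) → E2 → ℝ) :
    Prop where
  contDiff : ∀ a, ContDiff ℝ 2 (d a)
  bdd : ∃ M, ∀ a x, |d a x| ≤ M
  eqn : ∀ x, ∃ c : Fin l → ℝ, (∀ j, m * D.f j x ≤ c j) ∧ (∀ j, 0 ≤ c j) ∧ (∀ j, c j ≤ E) ∧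
    (∀ j, |lap (d (some j)) x - c j * (d (some j) x - d none x)| ≤ ρ) ∧
    |lap (d none) x + ∑ j, c j * (d (some j) x - d none x)| ≤ ρ
  sum : ∀ x, ∑ a, d a x = 0

theorem lin_bound_one {l : ℕ} (D : PlanarVortexData l) {m E : ℝ} (hm : 0 < m) (hE : 0 ≤ E) :
    ∃ A, ∀ d, LinSol D m E 1 d → ∀ a x, -A ≤ d a x := by
  obtain ⟨G, hG0, hG⟩ := g_bound D
  have hη : 0 < 1 / (G + 1) := by positivity
  set η := 1 / (G + 1) with hηd
  obtain ⟨θ, hθ, hθ1, hf⟩ := f_far' D (show 0 < η / 4 by positivity)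
  choose Bj hBj0 hBj using fun j => bf_bound D j hη
  set B := ∑ j, Bj j with hB
  have hB0 : 0 ≤ B := Finset.sum_nonneg fun j _ => hBj0 j
  set b : E2 → ℝ := fun x => ∑ j, bf D j η x with hb
  have hbc : ContDiff ℝ 2 b := ContDiff.sum fun j _ => bf_contDiff D j hη
  have hbB : ∀ x, |b x| ≤ B := fun x => (Finset.abs_sum_le_sum_abs _ _).trans
    (Finset.sum_le_sum fun j _ => hBj j x)
  have hbl : ∀ x, lap b x = ∑ j, qs D j η x - ∑ j, D.g j x := fun x => by
    rw [hb, lap_sum Finset.univ (fun j => bf_contDiff D j hη) x, ← Finset.sum_sub_distrib]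
    exact Finset.sum_congr rfl fun j _ => bf_lap D j hη x
  have hbG : ∀ x, -G ≤ lap b x := fun x => by
    rw [hbl]
    have := hG x
    have : 0 ≤ ∑ j, qs D j η x := Finset.sum_nonneg fun j _ => qs_nonneg D j hη x
    linarith
  have hbn : ∀ x, (∃ j k, ‖x - D.p j k‖ ^ 2 ≤ η) → 1 ≤ lap b x := by
    rintro x ⟨j, k, hk⟩
    rw [hbl]
    have h1 := hG x
    have h2 : qs D j η x ≤ ∑ j, qs D j η x :=
      Finset.single_le_sum (fun i _ => qs_nonneg D i hη x) (Finset.mem_univ j)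
    have h3 := qs_near D j hη x k hk
    have h4 : 1 / η = G + 1 := by rw [hηd]; field_simp
    linarith
  have hmθ : 0 < m * θ := by positivity
  set m' := m * θ
  set L := l * E with hL
  have hL0 : 0 ≤ L := by positivity
  set τ := L + E + 3 with hτ
  have hτ0 : 0 < τ := by positivity
  set K1 := (τ * G + 2) / m' with hK1
  have hK10 : 0 ≤ K1 := by positivity
  set κ := 2 * τ * B + 2 + K1 with hκ
  have hκ0 : 0 ≤ κ := by positivity
  set R := √η / 2 with hR
  have hR0 : 0 < R := by positivity
  set Q1 := (τ * G + 2 + L * 1) / m' with hQ1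
  have hQ10 : 0 ≤ Q1 := by positivity
  set Q2 := (1 + 4 * κ / R ^ 2 + L * κ) / m' with hQ2
  have hQ20 : 0 ≤ Q2 := by positivity
  refine ⟨Q1 + Q2 + K1 + 2 * τ * B + 1, fun d hd => ?_⟩
  obtain ⟨M, hM⟩ := hd.bdd
  have hτb : ∀ x, |τ * b x| ≤ τ * B := fun x => by
    rw [abs_mul, abs_of_pos hτ0]; exact mul_le_mul_of_nonneg_left (hbB x) hτ0.le
  have hτbc : ContDiff ℝ 2 (fun x => τ * b x) := contDiff_const.mul hbc
  obtain ⟨a, y, hy, hy2⟩ := family_min (u := fun a x => d a x - τ * b x)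
    (fun a => (hd.contDiff a).sub hτbc) (M := -M - τ * B)
    (fun a x => by
      have h1 := abs_le.1 (hM a x)
      have h2 := abs_le.1 (hτb x)
      linarith) (show (0 : ℝ) < 1 by norm_num)
  rw [lap_sub (hd.contDiff a) hτbc, lap_const_mul hbc] at hy2
  have hall : ∀ a' x, d a y - 2 * τ * B - 1 ≤ d a' x := fun a' x => by
    have h1 := hy a' x
    have h2 := abs_le.1 (hτb x)
    have h3 := abs_le.1 (hτb y)
    linarith
  have hloc : ∀ a', -1 ≤ d a' y - d a y := fun a' => by linarith [hy a' y]
  obtain ⟨c, hc1, hc2, hc3, hc4, hc5⟩ := hd.eqn y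
  have hcsum : ∑ j, c j ≤ L := by
    have := Finset.sum_le_sum (s := Finset.univ) fun j _ => hc3 j
    simpa using this
  have hLap : lap (d a) y ≤ L + E + 1 := by
    cases a with
    | some j =>
      have h1 := abs_le.1 (hc4 j)
      have h2 := hloc none
      have h3 : c j * (d (some j) y - d none y) ≤ c j * 1 :=
        mul_le_mul_of_nonneg_left (by linarith) (hc2 j)
      have h4 := hc3 j
      linarith
    | none =>
      have h1 := abs_le.1 hc5
      have h2 : ∑ j, c j * (-1) ≤ ∑ j, c j * (d (some j) y - d none y) :=
        Finset.sum_le_sum fun j _ => mul_le_mul_of_nonneg_left (hloc (some j)) (hc2 j)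
      rw [← Finset.sum_mul] at h2
      linarith
  have hnear : ∀ j k, η < ‖y - D.p j k‖ ^ 2 := by
    by_contra hcon
    push Not at hcon
    have h1 := hbn y hcon
    nlinarith
  have hLap2 : -(τ * G) - 1 ≤ lap (d a) y := by
    have := mul_le_mul_of_nonneg_left (hbG y) hτ0.le
    linarith
  have hfy : ∀ j, θ ≤ D.f j y := fun j => hf j y fun k => by linarith [hnear j k]
  have hcm : ∀ j, m' ≤ c j := fun j => (mul_le_mul_of_nonneg_left (hfy j) hm.le).trans (hc1 j)
  suffices hday : -(Q1 + Q2 + K1) ≤ d a y by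
    intro a' x
    have := hall a' x
    linarith
  cases a with
  | none =>
    have h1 := abs_le.1 hc5
    have h2 := core_bound (ξ := fun a => d a y) hmθ hcm hc3 (zero_le_one)
      (fun j => hloc (some j)) (P := τ * G + 2) (by linarith) (hd.sum y)
      (by positivity) hE
    linarith
  | some j =>
    have h1 := abs_le.1 (hc4 j)
    have h2 : d none y ≤ d (some j) y + K1 := by
      rcases le_total (d none y) (d (some j) y) with h | h
      · linarith
      · have e1 : m' * (d none y - d (some j) y) ≤ c j * (d none y - d (some j) y) :=
          mul_le_mul_of_nonneg_right (hcm j) (by linarith)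
        have e2 : d none y - d (some j) y ≤ K1 := by
          rw [hK1, le_div_iff₀ hmθ]
          linarith
        linarith
    obtain ⟨z, hz, hz2, hz3⟩ := local_min_principle (hd.contDiff none) hR0
      (m := d (some j) y - 2 * τ * B - 1) (κ := κ) (x := y) (fun z _ => hall none z)
      (by linarith)
    obtain ⟨c', hc1', hc2', hc3', hc4', hc5'⟩ := hd.eqn z
    have hfz : ∀ i, θ ≤ D.f i z := fun i => hf i z fun k => by
      have e1 : √η < ‖y - D.p i k‖ := by
        rw [Real.sqrt_lt' (lt_of_le_of_ne (norm_nonneg _) ?_)]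
        · exact hnear i k
        · intro h0
          have := hnear i k
          rw [← h0] at this
          norm_num at this
          linarith
      have e2 : ‖y - D.p i k‖ ≤ dist z y + ‖z - D.p i k‖ := by
        rw [dist_comm, dist_eq_norm]
        have : y - D.p i k = (y - z) + (z - D.p i k) := by abel
        rw [this]; exact norm_add_le _ _
      have e3 : √η / 2 ≤ ‖z - D.p i k‖ := by linarith
      have e4 : (√η / 2) ^ 2 = η / 4 := by
        rw [div_pow, Real.sq_sqrt hη.le]; norm_num
      rw [← e4]
      exact pow_le_pow_left₀ (by positivity) e3 2
    have hcm' : ∀ i, m' ≤ c' i := fun i =>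
      (mul_le_mul_of_nonneg_left (hfz i) hm.le).trans (hc1' i)
    have h5 := abs_le.1 hc5'
    have h6 := core_bound (ξ := fun a => d a z) hmθ hcm' hc3' hκ0
      (fun i => by
        have := hall (some i) z
        linarith) (P := 1 + 4 * κ / R ^ 2) (by linarith) (hd.sum z)
      (by positivity) hE
    linarith

theorem lin_bound {l : ℕ} (D : PlanarVortexData l) {m E : ℝ} (hm : 0 < m) (hE : 0 ≤ E) :
    ∃ A, 0 ≤ A ∧ ∀ ρ, 0 < ρ → ∀ d, LinSol D m E ρ d → ∀ a x, |d a x| ≤ A * ρ := by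
  obtain ⟨A, hA⟩ := lin_bound_one D hm hE
  refine ⟨(l + 1) * |A|, by positivity, fun ρ hρ d hd a x => ?_⟩
  have hlow : ∀ a x, -(ρ * A) ≤ d a x := by
    have : LinSol D m E 1 (fun a x => ρ⁻¹ * d a x) := by
      obtain ⟨M, hM⟩ := hd.bdd
      refine ⟨fun a => contDiff_const.mul (hd.contDiff a), ⟨ρ⁻¹ * M, fun a x => ?_⟩,
        fun x => ?_, fun x => ?_⟩
      · rw [abs_mul, abs_of_pos (by positivity)]
        exact mul_le_mul_of_nonneg_left (hM a x) (by positivity)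
      · obtain ⟨c, h1, h2, h3, h4, h5⟩ := hd.eqn x
        refine ⟨c, h1, h2, h3, fun j => ?_, ?_⟩
        · rw [lap_const_mul (hd.contDiff _)]
          have e : ρ⁻¹ * lap (d (some j)) x - c j * (ρ⁻¹ * d (some j) x - ρ⁻¹ * d none x)
            = ρ⁻¹ * (lap (d (some j)) x - c j * (d (some j) x - d none x)) := by ring
          rw [e, abs_mul, abs_of_pos (by positivity), inv_mul_le_iff₀ hρ, mul_one]
          exact h4 j
        · rw [lap_const_mul (hd.contDiff _)]
          have e : ρ⁻¹ * lap (d none) x + ∑ j, c j * (ρ⁻¹ * d (some j) x - ρ⁻¹ * d none x)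
            = ρ⁻¹ * (lap (d none) x + ∑ j, c j * (d (some j) x - d none x)) := by
            rw [mul_add, Finset.mul_sum]
            congr 1
            exact Finset.sum_congr rfl fun j _ => by ring
          rw [e, abs_mul, abs_of_pos (by positivity), inv_mul_le_iff₀ hρ, mul_one]
          exact h5
      · rw [← Finset.mul_sum, hd.sum x, mul_zero]
    intro a x
    have h1 := hA _ this a x
    have h2 : ρ * (ρ⁻¹ * d a x) = d a x := by field_simp
    have h3 := mul_le_mul_of_nonneg_left h1 hρ.le
    linarith
  have := abs_of_lower (ξ := fun a => d a x) (M := ρ * |A|) (hd.sum x) (fun a => by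
    have h1 := hlow a x
    have h2 := mul_le_mul_of_nonneg_left (le_abs_self A) hρ.le
    linarith) a
  calc _ ≤ _ := this
    _ = _ := by ring

/-- Difference of two regularised solutions. -/
theorem diff_bound {l : ℕ} (D : PlanarVortexData l) (C M : ℝ) :
    ∃ A, 0 ≤ A ∧ ∀ ε δ, 0 ≤ ε → 0 ≤ δ → 0 < ε + δ → ∀ w w', EpsSol D C ε w → EpsSol D C δ w' →
      (∀ a x, |w a x| ≤ M) → (∀ a x, |w' a x| ≤ M) →
      ∀ a x, |w a x - w' a x| ≤ A * (ε + δ) := by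
  obtain ⟨A, hA0, hA⟩ := lin_bound D (m := Real.exp (min (-(2 * M)) C)) (E := Real.exp C)
    (Real.exp_pos _) (Real.exp_pos _).le
  refine ⟨A * (|M| + 1), by positivity, fun ε δ hε hδ hs w w' hw hw' hM hM' a x => ?_⟩
  have key : LinSol D (Real.exp (min (-(2 * M)) C)) (Real.exp C) ((|M| + 1) * (ε + δ))
      (fun a x => w a x - w' a x) := by
    refine ⟨fun a => (hw.contDiff a).sub (hw'.contDiff a), ⟨2 * M, fun a x => ?_⟩, fun x => ?_,
      fun x => ?_⟩
    · have h1 := abs_le.1 (hM a x)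
      have h2 := abs_le.1 (hM' a x)
      rw [abs_le]
      constructor <;> linarith
    · obtain ⟨c, h1, h2, h3, h4, h5⟩ := Fa_slope D C x (fun b => w b x) (fun b => w' b x)
      have hr : ∀ a, |ε * w a x - δ * w' a x| ≤ (|M| + 1) * (ε + δ) := by
        intro a
        have e1 : |w a x| ≤ |M| + 1 := (hM a x).trans (by linarith [le_abs_self M])
        have e2 : |w' a x| ≤ |M| + 1 := (hM' a x).trans (by linarith [le_abs_self M])
        refine (abs_sub _ _).trans ?_
        rw [abs_mul, abs_mul, abs_of_nonneg hε, abs_of_nonneg hδ]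
        have e3 := mul_le_mul_of_nonneg_left e1 hε
        have e4 := mul_le_mul_of_nonneg_left e2 hδ
        linarith
      refine ⟨c, fun j => le_trans ?_ (h1 j), h2, h3, fun j => ?_, ?_⟩
      · refine mul_le_mul_of_nonneg_right (Real.exp_le_exp.2 ?_) (f_nonneg D j x)
        refine min_le_min_right _ (le_min ?_ ?_)
        · have e1 := abs_le.1 (hM (some j) x)
          have e2 := abs_le.1 (hM none x)
          linarith
        · have e1 := abs_le.1 (hM' (some j) x)
          have e2 := abs_le.1 (hM' none x)
          linarith
      · rw [lap_sub (hw.contDiff _) (hw'.contDiff _), hw.eqn, hw'.eqn]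
        refine le_trans (le_of_eq ?_) (hr (some j))
        congr 1
        linear_combination h4 j
      · rw [lap_sub (hw.contDiff _) (hw'.contDiff _), hw.eqn, hw'.eqn]
        refine le_trans (le_of_eq ?_) (hr none)
        congr 1
        have : ∑ j, c j * (w (some j) x - w' (some j) x - (w none x - w' none x)) =
          ∑ j, c j * ((w (some j) x - w' (some j) x) - (w none x - w' none x)) := rfl
        linear_combination h5
    · rw [Finset.sum_sub_distrib, hw.sum, hw'.sum, sub_zero]
  have := hA _ (by positivity) _ key a x
  calc _ ≤ _ := this
    _ = _ := by ring

end

open MeasureTheory Real Set Filter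

noncomputable section

/-! ### Passage to the limit and decay -/

theorem eps_sol_exists {l : ℕ} (D : PlanarVortexData l) (C : ℝ) {ε : ℝ} (hε : 0 < ε)
    (hε1 : ε ≤ 1) : ∃ w : Option (Fin l) → E2 → ℝ, EpsSol D C ε w ∧ (∀ a, CB1 (w a)) ∧
      ∀ a x, w a x = Res (l * Real.exp C + 1)
        (fun y => Hk D C (l * Real.exp C + 1 - ε) a y (fun b => w b y)) x := by
  have hlam : 0 < l * Real.exp C + 1 := by positivity
  obtain ⟨w, hw, hwe⟩ := eps_solution D (C := C) (κ := l * Real.exp C + 1 - ε)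
    (lam := l * Real.exp C + 1) (by linarith) hlam (by linarith)
  obtain ⟨h1, h2, h3⟩ := solution_of_Res D hlam hw hwe
  have h4 : ∀ a x, lap (w a) x = Fa D C a x (fun b => w b x) + ε * w a x := fun a x => by
    rw [h3]; ring
  exact ⟨w, ⟨h1, h2, h4, sum_zero D hε h1 h2 h4⟩, hw, hwe⟩

theorem limit_solution {l : ℕ} (D : PlanarVortexData l) : ∃ C M, ∃ w : Option (Fin l) → E2 → ℝ,
    EpsSol D C 0 w ∧ (∀ j x, w (some j) x - w none x ≤ C) ∧ ∀ a x, |w a x| ≤ M := by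
  obtain ⟨C, hC, hub⟩ := upper_bound D
  obtain ⟨M, hM0, hMb⟩ := full_bound D hC
  obtain ⟨A, hA0, hA⟩ := diff_bound D C M
  set lam : ℝ := l * Real.exp C + 1 with hlamd
  have hlam : 0 < lam := by positivity
  set e : ℕ → ℝ := fun n => 1 / ((n : ℝ) + 1) with he
  have he0 : ∀ n, 0 < e n := fun n => by positivity
  have he1 : ∀ n, e n ≤ 1 := fun n => by
    rw [he]; simp only
    rw [div_le_one (by positivity)]
    linarith [(Nat.cast_nonneg n : (0 : ℝ) ≤ n)]
  have het : Tendsto e atTop (nhds 0) := tendsto_one_div_add_atTop_nhds_zero_nat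
  choose w hw hwc hwr using fun n => eps_sol_exists D C (he0 n) (he1 n)
  have hwM : ∀ n a x, |w n a x| ≤ M := fun n =>
    hMb (e n) (he0 n).le _ (hw n) (hub (e n) (he0 n).le _ (hw n))
  have hdiff : ∀ n m a x, |w n a x - w m a x| ≤ A * (e n + e m) := fun n m =>
    hA (e n) (e m) (he0 n).le (he0 m).le (add_pos (he0 n) (he0 m)) _ _ (hw n) (hw m)
      (hwM n) (hwM m)
  have hcau : ∀ a x, CauchySeq (fun n => w n a x) := by
    intro a x
    rw [Metric.cauchySeq_iff']
    intro ε hε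
    have ht : Tendsto (fun n => A * (e n + e n)) atTop (nhds 0) := by
      simpa using (het.add het).const_mul A
    have hmono : ∀ n N, N ≤ n → e n ≤ e N := fun n N h =>
      one_div_le_one_div_of_le (by positivity) (by
        have : (N : ℝ) ≤ n := by exact_mod_cast h
        linarith)
    obtain ⟨N, hN⟩ := (ht.eventually (gt_mem_nhds hε)).exists
    refine ⟨N, fun n hn => ?_⟩
    rw [Real.dist_eq]
    refine (hdiff n N a x).trans_lt (lt_of_le_of_lt ?_ hN)
    exact mul_le_mul_of_nonneg_left (by linarith [hmono n N hn]) hA0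
  choose W hW using fun a x => cauchySeq_tendsto_of_complete (hcau a x)
  have hWd : ∀ n a x, |W a x - w n a x| ≤ A * e n := by
    intro n a x
    have h1 : Tendsto (fun m => |w m a x - w n a x|) atTop (nhds |W a x - w n a x|) :=
      ((hW a x).sub_const _).abs
    have h2 : Tendsto (fun m => A * (e m + e n)) atTop (nhds (A * (0 + e n))) :=
      (het.add_const _).const_mul A
    have := le_of_tendsto_of_tendsto' h1 h2 (fun m => hdiff m n a x)
    simpa using this
  have hWM : ∀ a x, |W a x| ≤ M := fun a x => le_of_tendsto' (hW a x).abs fun n => hwM n a x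
  have hAe : Tendsto (fun n => A * e n) atTop (nhds 0) := by simpa using het.const_mul A
  have hWcont : ∀ a, Continuous (W a) := by
    intro a
    have hu : TendstoUniformly (fun n => w n a) (W a) atTop := by
      rw [Metric.tendstoUniformly_iff]
      intro ε hε
      filter_upwards [hAe.eventually (gt_mem_nhds hε)] with n hn x
      rw [Real.dist_eq]
      exact (hWd n a x).trans_lt hn
    exact hu.continuous (Frequently.of_forall fun n => (hwc n a).continuous)
  have hWpi : Continuous (fun x a => W a x) := continuous_pi hWcont
  have hκl : l * Real.exp C ≤ lam := by linarith
  obtain ⟨A', hA'0, hA'⟩ := Hk_bound D hκl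
  have hlim : ∀ a n y, ‖Hk D C lam a y (fun b => W b y)
      - Hk D C (lam - e n) a y (fun b => w n b y)‖ ≤ lam * (A * e n) + e n * M := by
    intro a n y
    have h1 := Hk_lip D hκl a y (ξ := fun b => W b y) (ζ := fun b => w n b y)
      (fun b => hWd n b y)
    have h2 : Hk D C lam a y (fun b => W b y) - Hk D C (lam - e n) a y (fun b => w n b y)
      = (Hk D C lam a y (fun b => W b y) - Hk D C lam a y (fun b => w n b y))
        + e n * w n a y := by
      unfold Hk; ring
    rw [h2]
    refine (norm_add_le _ _).trans (add_le_add h1 ?_)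
    rw [Real.norm_eq_abs, abs_mul, abs_of_pos (he0 n)]
    exact mul_le_mul_of_nonneg_left (hwM n a y) (he0 n).le
  have hδ : Tendsto (fun n => lam * (A * e n) + e n * M) atTop (nhds 0) := by
    simpa using (hAe.const_mul lam).add (het.mul_const M)
  have hres := fun a => Res_limit hlam (Hk_continuous D C lam a hWpi)
    (hA' a (fun x a => W a x) M (fun x a => hWM a x))
    (fun n => Hk_CB1 D C (lam - e n) a (hwc n)) hδ (hlim a)
  have hWr : ∀ a x, W a x = Res lam (fun y => Hk D C lam a y (fun b => W b y)) x := by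
    intro a x
    refine tendsto_nhds_unique (hW a x) ?_
    have h1 := (hres a).2 x
    refine h1.congr fun n => ?_
    rw [hwr n a x]
  have hWCB : ∀ a, CB1 (W a) := fun a => by
    have h1 : W a = Res lam (fun y => Hk D C lam a y (fun b => W b y)) := funext (hWr a)
    rw [h1]
    exact (hres a).1
  obtain ⟨h1, h2, h3⟩ := solution_of_Res D hlam hWCB hWr
  have hsol : EpsSol D C 0 W := by
    refine ⟨h1, h2, fun a x => by rw [h3]; ring, fun x => ?_⟩
    have h5 : Tendsto (fun n => ∑ a, w n a x) atTop (nhds (∑ a, W a x)) :=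
      tendsto_finsetSum _ fun a _ => hW a x
    have h6 : (fun n => ∑ a, w n a x) = fun _ => (0 : ℝ) := by
      funext n; exact (hw n).sum x
    rw [h6] at h5
    exact tendsto_nhds_unique h5 tendsto_const_nhds
  exact ⟨C, M, W, hsol, hub 0 le_rfl _ hsol, hWM⟩

theorem norm_sub_sq_atTop (p : E2) :
    Tendsto (fun x : E2 => ‖x - p‖ ^ 2) (cocompact E2) atTop := by
  have h1 : Tendsto (fun x : E2 => x - p) (cocompact E2) (cocompact E2) :=
    (Homeomorph.subRight p).isClosedEmbedding.tendsto_cocompact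
  exact (tendsto_pow_atTop (by norm_num)).comp (tendsto_norm_cocompact_atTop.comp h1)

theorem f_tendsto {l : ℕ} (D : PlanarVortexData l) (j : Fin l) :
    Tendsto (D.f j) (cocompact E2) (nhds 1) := by
  have : Tendsto (D.f j) (cocompact E2) (nhds (∏ k : Fin (D.N j), 1)) := by
    refine tendsto_finsetProd _ fun k _ => ?_
    have h1 : Tendsto (fun x : E2 => D.μ + ‖x - D.p j k‖ ^ 2) (cocompact E2) atTop :=
      tendsto_atTop_add_const_left _ _ (norm_sub_sq_atTop _)
    have h2 := (h1.const_div_atTop D.μ).const_sub 1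
    rw [sub_zero] at h2
    refine h2.congr fun x => ?_
    have := D.μ_pos
    have : D.μ + ‖x - D.p j k‖ ^ 2 ≠ 0 := by positivity
    field_simp
    ring
  simpa using this

theorem g_tendsto {l : ℕ} (D : PlanarVortexData l) (j : Fin l) :
    Tendsto (D.g j) (cocompact E2) (nhds 0) := by
  have : Tendsto (D.g j) (cocompact E2) (nhds (∑ k : Fin (D.N j), 0)) := by
    refine tendsto_finsetSum _ fun k _ => ?_
    have h1 : Tendsto (fun x : E2 => D.μ + ‖x - D.p j k‖ ^ 2) (cocompact E2) atTop :=
      tendsto_atTop_add_const_left _ _ (norm_sub_sq_atTop _)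
    exact ((tendsto_pow_atTop (n := 2) (by norm_num)).comp h1).const_div_atTop (4 * D.μ)
  simpa using this

theorem hh_tendsto {l : ℕ} (D : PlanarVortexData l) (j : Fin l) :
    Tendsto (hh D j) (cocompact E2) (nhds 0) := by
  have h1 : Tendsto (fun x => ∑ i, D.g i x) (cocompact E2) (nhds (∑ i : Fin l, 0)) :=
    tendsto_finsetSum _ fun i _ => g_tendsto D i
  have := (g_tendsto D j).sub (h1.div_const ((l : ℝ) + 1))
  simp only [Finset.sum_const_zero, zero_div, sub_zero] at this
  exact this

theorem decay {l : ℕ} (D : PlanarVortexData l) {C M : ℝ} {w : Option (Fin l) → E2 → ℝ}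
    (hw : EpsSol D C 0 w) (hv : ∀ j x, w (some j) x - w none x ≤ C) (hM : ∀ a x, |w a x| ≤ M)
    (a : Option (Fin l)) : Tendsto (w a) (cocompact E2) (nhds 0) := by
  have hnone : ∀ σ > 0, ∀ᶠ y in cocompact E2, -σ ≤ w none y := by
    intro σ hσ
    refine min_principle_infinity (hw.contDiff none) (hM none) (δ := σ / 2) (by positivity) ?_
    have ht : Tendsto (fun y => ∑ j, ((1 - D.f j y) * Real.exp C - hh D j y)) (cocompact E2)
        (nhds (∑ j : Fin l, ((1 - 1) * Real.exp C - 0))) :=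
      tendsto_finsetSum _ fun j _ => (((f_tendsto D j).const_sub 1).mul_const _).sub
        (hh_tendsto D j)
    simp only [sub_self, zero_mul, Finset.sum_const_zero] at ht
    filter_upwards [ht.eventually (gt_mem_nhds (show 0 < σ / 2 by positivity))] with y hy hyw
    rw [hw.eqn]
    simp only [Fa, Fj]
    have h1 : ∀ j, (w (some j) y - w none y) - ((1 - D.f j y) * Real.exp C - hh D j y)
        ≤ D.f j y * Ex C (w (some j) y - w none y) - 1 + hh D j y := by
      intro j
      rw [Ex_eq (hv j y)]
      have e1 := Real.add_one_le_exp (w (some j) y - w none y)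
      have e2 := Real.exp_le_exp.2 (hv j y)
      have e3 := mul_le_mul_of_nonneg_left e2 (sub_nonneg.2 (f_le_one D j y))
      linarith
    have h2 := Finset.sum_le_sum (s := Finset.univ) fun j _ => h1 j
    rw [Finset.sum_sub_distrib, Finset.sum_sub_distrib] at h2
    have h3 := hw.sum y
    rw [Fintype.sum_option] at h3
    simp only [Finset.sum_const, Finset.card_univ, Fintype.card_fin, nsmul_eq_mul] at h2
    have hl : (0 : ℝ) ≤ l := by positivity
    nlinarith
  have hsome : ∀ j, ∀ σ > 0, ∀ᶠ y in cocompact E2, -(2 * σ) ≤ w (some j) y := by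
    intro j σ hσ
    have hlt : Real.exp (-σ) < 1 := by rw [Real.exp_lt_one_iff]; linarith
    refine min_principle_infinity (hw.contDiff _) (hM _) (δ := (1 - Real.exp (-σ)) / 2)
      (by linarith) ?_
    filter_upwards [(hh_tendsto D j).eventually (gt_mem_nhds
      (show 0 < (1 - Real.exp (-σ)) / 2 by linarith)), hnone σ hσ] with y hy hy0 hyw
    rw [hw.eqn]
    simp only [Fa, Fj]
    rw [Ex_eq (hv j y)]
    have e1 : Real.exp (w (some j) y - w none y) ≤ Real.exp (-σ) :=
      Real.exp_le_exp.2 (by linarith)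
    have e2 := mul_le_mul_of_nonneg_right (f_le_one D j y)
      (Real.exp_pos (w (some j) y - w none y)).le
    linarith
  have hall : ∀ σ > 0, ∀ᶠ y in cocompact E2, ∀ a, -σ ≤ w a y := by
    intro σ hσ
    rw [eventually_all]
    intro a
    cases a with
    | none => exact hnone σ hσ
    | some j =>
      have := hsome j (σ / 2) (by positivity)
      filter_upwards [this] with y hy
      linarith
  rw [Metric.tendsto_nhds]
  intro ε hε
  filter_upwards [hall (ε / (2 * (l + 1))) (by positivity)] with y hy
  have h1 := abs_of_lower (ξ := fun a => w a y) (hw.sum y) hy a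
  rw [Real.dist_eq, sub_zero]
  refine h1.trans_lt ?_
  have : ((l : ℝ) + 1) * (ε / (2 * (l + 1))) = ε / 2 := by field_simp
  rw [this]
  linarith

end

/-- for any choice of the data, a planar vortex solution exists. -/
theorem existence_of_planar_vortex_solution {l : ℕ} (hl : 2 ≤ l)
    (D : PlanarVortexData l) :
    ∃ v : Fin l → E2 → ℝ, IsPlanarVortexSolution D v := by
  obtain ⟨C, M, w, hw, hv, hM⟩ := limit_solution D
  refine ⟨fun j x => w (some j) x - w none x, fun j => ⟨(hw.contDiff _).sub (hw.contDiff _),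
    fun x => ?_, ?_⟩⟩
  · rw [hw.lap_v]
    simp only [Ex_eq (hv _ x)]
    ring
  · simpa using (decay D hw hv hM (some j)).sub (decay D hw hv hM none)
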